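/- arXiv:1201.2350 — 5 statements merged into one kernel-verified Lean document; each statement's English description precedes it below -/
import Mathlib

section
/- Let η : ℝ → [0,∞) be even, convex, of class C¹, with η(0) = 0, and suppose that liminf_{r→0+} η(r)/r² > 0 and lim_{r→∞} η(r)/r² = ∞. Then there exists a function ψ : ℝ → [0,∞) which is even, convex, of class C¹, with ψ(0) = 0, satisfying the homogeneous doubling condition (there exists q ≥ 1 such that ψ(λr) ≤ λ^q ψ(r) for all r ∈ ℝ and λ ≥ 1), and such that ψ(r) ≤ η(r) for all r ∈ ℝ and lim_{r→∞} ψ(r)/r² = ∞. -/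
open Real Filter Topology intervalIntegral

/-- An even function, concave on the positive half-line and at most `2 * η s / s ^ 2` there. -/
noncomputable def slowMinorant (η : ℝ → ℝ) (s : ℝ) : ℝ :=
  ⨅ t : Set.Ioi (0 : ℝ), η t / (t : ℝ) ^ 2 * (1 + |s| / t)

section slowMinorant

variable {η : ℝ → ℝ}

lemma slowMinorant_le (hη : ∀ r, 0 ≤ η r) (s : ℝ) {t : ℝ} (ht : 0 < t) :
    slowMinorant η s ≤ η t / t ^ 2 * (1 + |s| / t) := by
  refine ciInf_le (f := fun t : Set.Ioi (0 : ℝ) => η t / (t : ℝ) ^ 2 * (1 + |s| / t))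
    ⟨0, ?_⟩ ⟨t, ht⟩
  rintro _ ⟨⟨u, hu⟩, rfl⟩
  have hu' : (0 : ℝ) < u := hu
  have := hη u
  dsimp only
  positivity

lemma le_slowMinorant {a s : ℝ} (h : ∀ t > 0, a ≤ η t / t ^ 2 * (1 + |s| / t)) :
    a ≤ slowMinorant η s := by
  have : Nonempty (Set.Ioi (0 : ℝ)) := ⟨⟨1, Set.mem_Ioi.2 one_pos⟩⟩
  exact le_ciInf fun t => h t t.2

lemma slowMinorant_nonneg (hη : ∀ r, 0 ≤ η r) (s : ℝ) : 0 ≤ slowMinorant η s :=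
  le_slowMinorant fun t ht => by
    have := hη t
    positivity

lemma slowMinorant_abs (s : ℝ) : slowMinorant η |s| = slowMinorant η s := by
  simp [slowMinorant]

lemma slowMinorant_neg (s : ℝ) : slowMinorant η (-s) = slowMinorant η s := by
  simp [slowMinorant]

lemma slowMinorant_mono (hη : ∀ r, 0 ≤ η r) {s u : ℝ} (h : |s| ≤ |u|) :
    slowMinorant η s ≤ slowMinorant η u :=
  le_slowMinorant fun t ht => (slowMinorant_le hη s ht).trans <| by
    have := hη t
    gcongr

lemma slowMinorant_mul_le (hη : ∀ r, 0 ≤ η r) {l : ℝ} (hl : 1 ≤ l) (s : ℝ) :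
    slowMinorant η (l * s) ≤ l * slowMinorant η s := by
  have hl0 : 0 < l := one_pos.trans_le hl
  rw [← div_le_iff₀' hl0]
  refine le_slowMinorant fun t ht => ?_
  rw [div_le_iff₀' hl0]
  refine (slowMinorant_le hη (l * s) ht).trans ?_
  have := hη t
  rw [abs_mul, abs_of_pos hl0]
  calc η t / t ^ 2 * (1 + l * |s| / t) ≤ η t / t ^ 2 * (l + l * |s| / t) := by gcongr
    _ = l * (η t / t ^ 2 * (1 + |s| / t)) := by ring

lemma concaveOn_slowMinorant (hη : ∀ r, 0 ≤ η r) :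
    ConcaveOn ℝ (Set.Ioi 0) (slowMinorant η) := by
  refine ⟨convex_Ioi 0, fun x hx y hy a b ha hb hab => le_slowMinorant fun t ht => ?_⟩
  have hx' : (0 : ℝ) < x := hx
  have hy' : (0 : ℝ) < y := hy
  have h1 := mul_le_mul_of_nonneg_left (slowMinorant_le hη x ht) ha
  have h2 := mul_le_mul_of_nonneg_left (slowMinorant_le hη y ht) hb
  rw [abs_of_pos hx'] at h1
  rw [abs_of_pos hy'] at h2
  have h3 : |a • x + b • y| = a * x + b * y := by
    simp only [smul_eq_mul]
    exact abs_of_nonneg (by positivity)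
  rw [h3]
  simp only [smul_eq_mul]
  calc _ ≤ _ := add_le_add h1 h2
    _ = η t / t ^ 2 * ((a + b) + (a * x + b * y) / t) := by ring
    _ = _ := by rw [hab]

lemma continuous_mul_slowMinorant (hη : ∀ r, 0 ≤ η r) :
    Continuous fun s => s * slowMinorant η s := by
  rw [continuous_iff_continuousAt]
  intro s
  rcases eq_or_ne s 0 with rfl | hs
  · rw [ContinuousAt, zero_mul]
    have hlim : Tendsto (fun s : ℝ => |s| * slowMinorant η 1) (𝓝 0) (𝓝 0) := by
      have : Continuous fun s : ℝ => |s| * slowMinorant η 1 := by fun_prop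
      simpa using this.tendsto 0
    refine squeeze_zero_norm' ?_ hlim
    filter_upwards [Metric.closedBall_mem_nhds (0 : ℝ) one_pos] with s hs
    rw [norm_mul, Real.norm_eq_abs, Real.norm_of_nonneg (slowMinorant_nonneg hη s)]
    gcongr
    exact slowMinorant_mono hη (by simpa using hs)
  · have hc := (concaveOn_slowMinorant hη).continuousOn isOpen_Ioi
    have h1 : ContinuousAt (slowMinorant η) |s| :=
      hc.continuousAt (Ioi_mem_nhds (abs_pos.2 hs))
    have h2 : ContinuousAt (fun s : ℝ => slowMinorant η |s|) s :=
      ContinuousAt.comp (f := fun s : ℝ => |s|) h1 continuous_abs.continuousAt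
    simp only [slowMinorant_abs] at h2
    exact continuousAt_id.mul h2

lemma monotone_mul_slowMinorant (hη : ∀ r, 0 ≤ η r) :
    Monotone fun s => s * slowMinorant η s := by
  refine monotone_of_odd_of_monotoneOn_nonneg (fun s => by simp [slowMinorant_neg]) ?_
  intro x hx y hy hxy
  have hx' : 0 ≤ x := hx
  have hy' : 0 ≤ y := hy
  exact mul_le_mul hxy
    (slowMinorant_mono hη (by rwa [abs_of_nonneg hx', abs_of_nonneg hy']))
    (slowMinorant_nonneg hη x) hy'

lemma tendsto_slowMinorant_atTop (hη : ∀ r, 0 ≤ η r) {c : ℝ} (hc : 0 < c)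
    (hcη : ∀ t > 0, c ≤ η t / t ^ 2)
    (hinf : Tendsto (fun r : ℝ => η r / r ^ 2) atTop atTop) :
    Tendsto (slowMinorant η) atTop atTop := by
  refine tendsto_atTop.2 fun M => ?_
  obtain ⟨T, hT⟩ := eventually_atTop.1 (hinf.eventually_ge_atTop M)
  have hlin : Tendsto (fun s : ℝ => c * (s / max T 1)) atTop atTop :=
    (tendsto_id.atTop_div_const (by positivity)).const_mul_atTop hc
  filter_upwards [hlin.eventually_ge_atTop M, eventually_ge_atTop 0] with s hs hs0
  refine le_slowMinorant fun t ht => ?_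
  have := hη t
  rw [abs_of_nonneg hs0]
  rcases le_total T t with h | h
  · refine (hT t h).trans (le_mul_of_one_le_right (by positivity) ?_)
    have : 0 ≤ s / t := by positivity
    linarith
  · refine hs.trans (mul_le_mul (hcη t ht) ?_ (by positivity) (by positivity))
    have : s / max T 1 ≤ s / t := by
      gcongr
      exact h.trans (le_max_left _ _)
    linarith

end slowMinorant

/-- A convex function vanishing at the origin, at least quadratic near `0+` and near `+∞`, is
bounded below by a positive multiple of `t ^ 2` on the positive half-line. -/
lemma exists_pos_le_div_sq {η : ℝ → ℝ} (hη : ∀ r, 0 ≤ η r) (hconv : ConvexOn ℝ Set.univ η)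
    (h0 : η 0 = 0)
    (hliminf : 0 < liminf (fun r : ℝ => η r / r ^ 2) (𝓝[>] 0))
    (hinf : Tendsto (fun r : ℝ => η r / r ^ 2) atTop atTop) :
    ∃ c > 0, ∀ t > 0, c ≤ η t / t ^ 2 := by
  have hbdd : IsBoundedUnder (· ≥ ·) (𝓝[>] 0) fun r : ℝ => η r / r ^ 2 :=
    isBoundedUnder_of ⟨0, fun r => div_nonneg (hη r) (sq_nonneg r)⟩
  obtain ⟨a, ha, hal⟩ := exists_between hliminf
  have hev := eventually_lt_of_lt_liminf hal hbdd
  obtain ⟨δ, hδ, hδη⟩ := mem_nhdsGT_iff_exists_Ioc_subset.1 hev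
  have hδ0 : (0 : ℝ) < δ := hδ
  obtain ⟨T, hT⟩ := eventually_atTop.1 (hinf.eventually_ge_atTop 1)
  have hδa : a < η δ / δ ^ 2 := hδη ⟨hδ0, le_rfl⟩
  have hηδ : 0 < η δ := by
    have := ha.trans hδa
    rwa [div_pos_iff_of_pos_right (by positivity)] at this
  refine ⟨min a (min 1 (η δ / (max T 1) ^ 2)), by positivity, fun t ht => ?_⟩
  rcases le_total t δ with h | h
  · exact (min_le_left _ _).trans (le_of_lt (hδη ⟨ht, h⟩))
  refine (min_le_right _ _).trans ?_
  rcases le_total T t with h' | h'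
  · exact (min_le_left _ _).trans (hT t h')
  refine (min_le_right _ _).trans ?_
  have hmono : η δ ≤ η t := by
    have := hconv.2 (Set.mem_univ 0) (Set.mem_univ t)
      (sub_nonneg.2 ((div_le_one ht).2 h)) (div_nonneg hδ0.le ht.le) (sub_add_cancel _ _)
    simp only [smul_eq_mul, h0, mul_zero, zero_add, div_mul_cancel₀ _ ht.ne'] at this
    exact this.trans (mul_le_of_le_one_left (hη t) ((div_le_one ht).2 h))
  have := h'.trans (le_max_left T 1)
  have := hη t
  gcongr

/-- If `η : ℝ → [0,∞)` is even, convex, `C¹`, vanishes at `0`,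
has `liminf_{r→0+} η(r)/r² > 0` and `η(r)/r² → ∞` as `r → ∞`, then there is an even,
convex, `C¹` function `ψ : ℝ → [0,∞)` with `ψ(0) = 0` satisfying the homogeneous doubling
condition, with `ψ ≤ η` everywhere and `ψ(r)/r² → ∞` as `r → ∞`. -/
theorem stmt1 (η : ℝ → ℝ)
    (hnonneg : ∀ r : ℝ, 0 ≤ η r)
    (heven : ∀ r : ℝ, η (-r) = η r)
    (hconv : ConvexOn ℝ Set.univ η)
    (hC1 : ContDiff ℝ 1 η)
    (h0 : η 0 = 0)
    (hliminf : 0 < Filter.liminf (fun r : ℝ => η r / r ^ 2) (nhdsWithin 0 (Set.Ioi 0)))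
    (hinf : Tendsto (fun r : ℝ => η r / r ^ 2) atTop atTop) :
    ∃ ψ : ℝ → ℝ,
      (∀ r : ℝ, 0 ≤ ψ r) ∧
      (∀ r : ℝ, ψ (-r) = ψ r) ∧
      ConvexOn ℝ Set.univ ψ ∧
      ContDiff ℝ 1 ψ ∧
      ψ 0 = 0 ∧
      (∃ q : ℝ, 1 ≤ q ∧ ∀ r l : ℝ, 1 ≤ l → ψ (l * r) ≤ l ^ q * ψ r) ∧
      (∀ r : ℝ, ψ r ≤ η r) ∧
      Tendsto (fun r : ℝ => ψ r / r ^ 2) atTop atTop := by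
  obtain ⟨c, hc, hcη⟩ := exists_pos_le_div_sq hnonneg hconv h0 hliminf hinf
  have hφc := continuous_mul_slowMinorant hnonneg
  have hφm := monotone_mul_slowMinorant hnonneg
  set φ : ℝ → ℝ := fun s => s * slowMinorant η s with hφ
  have hi : ∀ a b, IntervalIntegrable φ MeasureTheory.volume a b :=
    fun a b => hφc.intervalIntegrable a b
  have hφ0 : ∀ s, 0 ≤ s → 0 ≤ φ s := fun s hs => mul_nonneg hs (slowMinorant_nonneg hnonneg s)
  set ψ : ℝ → ℝ := fun r => ∫ s in (0 : ℝ)..r, φ s with hψ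
  have hderiv : ∀ r, HasDerivAt ψ (φ r) r := fun r => hφc.integral_hasStrictDerivAt 0 r |>.hasDerivAt
  have hderiv' : deriv ψ = φ := funext fun r => (hderiv r).deriv
  have hdiff : Differentiable ℝ ψ := fun r => (hderiv r).differentiableAt
  have hψeven : ∀ r, ψ (-r) = ψ r := fun r => by
    have h := integral_comp_neg (a := 0) (b := r) φ
    have hodd : ∀ s, φ (-s) = -φ s := fun s => by simp [hφ, slowMinorant_neg]
    simp only [hodd, integral_neg, neg_zero] at h
    simp only [hψ]
    rw [integral_symm (-r) 0, ← h, neg_neg]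
  have hψabs : ∀ r, ψ |r| = ψ r := fun r => by
    rcases abs_choice r with h | h <;> rw [h]
    exact hψeven r
  have hψ_nonneg : ∀ r, 0 ≤ ψ r := fun r => by
    rw [← hψabs]
    exact integral_nonneg (abs_nonneg r) fun s hs => hφ0 s hs.1
  refine ⟨ψ, hψ_nonneg, hψeven, ?_, ?_, by simp [hψ], ⟨3, by norm_num, ?_⟩, ?_, ?_⟩
  · exact Monotone.convexOn_univ_of_deriv hdiff (hderiv' ▸ hφm)
  · exact contDiff_one_iff_deriv.2 ⟨hdiff, hderiv' ▸ hφc⟩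
  · intro r l hl
    have hl0 : 0 < l := one_pos.trans_le hl
    rw [← hψabs (l * r), ← hψabs r, abs_mul, abs_of_pos hl0]
    have hsub : ψ (l * |r|) = l * ∫ s in (0 : ℝ)..|r|, φ (l * s) := by
      simp [hψ, mul_integral_comp_mul_left]
    have hle : ∫ s in (0 : ℝ)..|r|, φ (l * s) ≤ ∫ s in (0 : ℝ)..|r|, l ^ 2 * φ s := by
      refine integral_mono_on (abs_nonneg r)
        ((hφc.comp (continuous_const_mul l)).intervalIntegrable _ _)
        ((hi _ _).const_mul _) fun s hs => ?_
      calc l * s * slowMinorant η (l * s) ≤ l * s * (l * slowMinorant η s) :=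
            mul_le_mul_of_nonneg_left (slowMinorant_mul_le hnonneg hl s)
              (mul_nonneg hl0.le hs.1)
        _ = l ^ 2 * (s * slowMinorant η s) := by ring
    rw [integral_const_mul] at hle
    calc ψ (l * |r|) ≤ l * (l ^ 2 * ψ |r|) := hsub ▸ mul_le_mul_of_nonneg_left hle hl0.le
      _ = l ^ (3 : ℝ) * ψ |r| := by
        rw [show (3 : ℝ) = ((3 : ℕ) : ℝ) by norm_num, rpow_natCast]
        ring
  · intro r
    have hηabs : η |r| = η r := by
      rcases abs_choice r with h | h <;> rw [h]
      exact heven r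
    rw [← hψabs, ← hηabs]
    rcases (abs_nonneg r).eq_or_lt with h | h
    · simp [← h, hψ, h0]
    generalize |r| = x at h
    calc ψ x ≤ ∫ s in (0 : ℝ)..x, s * slowMinorant η x := by
          refine integral_mono_on h.le (hi _ _)
            ((continuous_id.mul continuous_const).intervalIntegrable _ _) fun s hs => ?_
          refine mul_le_mul_of_nonneg_left (slowMinorant_mono hnonneg ?_) hs.1
          rw [abs_of_nonneg hs.1, abs_of_pos h]
          exact hs.2
      _ = x ^ 2 / 2 * slowMinorant η x := by
          rw [integral_mul_const, integral_id]
          ring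
      _ ≤ x ^ 2 / 2 * (η x / x ^ 2 * (1 + |x| / x)) := by
          gcongr
          exact slowMinorant_le hnonneg x h
      _ = η x := by
          rw [abs_of_pos h]
          field_simp
          ring
  · have hw := tendsto_slowMinorant_atTop hnonneg hc hcη hinf
    have hlim : Tendsto (fun r : ℝ => slowMinorant η (r / 2) / 4) atTop atTop :=
      (hw.comp (tendsto_id.atTop_div_const two_pos)).atTop_div_const four_pos
    refine tendsto_atTop_mono' _ ?_ hlim
    filter_upwards [eventually_gt_atTop 0] with r hr
    rw [le_div_iff₀ (by positivity)]
    have hsplit : ψ (r / 2) + ∫ s in (r / 2)..r, φ s = ψ r :=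
      integral_add_adjacent_intervals (hi _ _) (hi _ _)
    have hle : ∫ _ in (r / 2)..r, φ (r / 2) ≤ ∫ s in (r / 2)..r, φ s :=
      integral_mono_on (by linarith) (by simp) (hi _ _) fun s hs => hφm hs.1
    rw [integral_const, smul_eq_mul] at hle
    calc slowMinorant η (r / 2) / 4 * r ^ 2 = (r - r / 2) * φ (r / 2) := by
          simp only [hφ]
          ring
      _ ≤ ψ r := by linarith [hψ_nonneg (r / 2)]
end

section
/- Let ψ : ℝ → [0,∞) be even and convex with lim_{|r|→∞} ψ(r)/r² = ∞, and define Ψ[X] := ∫₀¹ ψ(X(m)) dm for X ∈ L¹(Ω). Then for every α ≥ 0 the sublevel set { X ∈ K : Ψ[X] ≤ α } is a compact subset of L²(Ω). -/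
open MeasureTheory Set Filter
open scoped ENNReal NNReal RealInnerProductSpace

noncomputable section

/-- The interval `Ω = (0,1)`. -/
def Omg : Set ℝ := Set.Ioo 0 1

/-- Lebesgue measure restricted to `(0,1)`. -/
def mu : Measure ℝ := volume.restrict Omg

/-- The Hilbert space `L²(Ω)`. -/
abbrev L2 : Type := Lp ℝ 2 mu

/-- The cone `K` of functions in `L²(Ω)` admitting a nondecreasing representative. -/
def Kcone : Set L2 := {X | ∃ g : ℝ → ℝ, MonotoneOn g Omg ∧ ⇑X =ᵐ[mu] g}

/-- The integral functional `Ψ[X] = ∫₀¹ ψ(X(m)) dm` (with values in `[0,∞]`,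
appropriate since `ψ ≥ 0`). -/
def PsiL (ψ : ℝ → ℝ) (X : L2) : ℝ≥0∞ := ∫⁻ m, ENNReal.ofReal (ψ (X m)) ∂mu

/-- **Helly's selection theorem**: a pointwise bounded sequence of functions that are monotone on an
open set has a subsequence converging, off a countable set, to a monotone function. -/
theorem exists_subseq_tendsto_of_monotoneOn {s : Set ℝ} (hs : IsOpen s) {f : ℕ → ℝ → ℝ}
    (hf : ∀ n, MonotoneOn (f n) s) {B : ℝ → ℝ} (hB : ∀ n, ∀ x ∈ s, |f n x| ≤ B x) :
    ∃ φ : ℕ → ℕ, StrictMono φ ∧ ∃ g : ℝ → ℝ, MonotoneOn g s ∧ ∃ t : Set ℝ, t.Countable ∧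
      ∀ x ∈ s \ t, Tendsto (fun n => f (φ n) x) atTop (nhds (g x)) := by
  classical
  let F : ℕ → ℚ → ℝ := fun n q => if (q : ℝ) ∈ s then f n q else 0
  have hK : IsCompact (Set.univ.pi fun q : ℚ => Set.Icc (-|B q|) |B q|) :=
    isCompact_univ_pi fun q => isCompact_Icc
  have hFK : ∀ n, F n ∈ Set.univ.pi fun q : ℚ => Set.Icc (-|B q|) |B q| := by
    intro n q _
    rw [Set.mem_Icc, ← abs_le]
    by_cases hq : (q : ℝ) ∈ s
    · simpa [F, hq] using (hB n q hq).trans (le_abs_self _)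
    · simp [F, hq]
  obtain ⟨G, -, φ, hφ, hG⟩ := hK.tendsto_subseq hFK
  have hGq : ∀ q : ℚ, (q : ℝ) ∈ s → Tendsto (fun n => f (φ n) q) atTop (nhds (G q)) := by
    intro q hq
    simpa [F, hq, Function.comp_def] using (tendsto_pi_nhds.1 hG) q
  have hle : ∀ x ∈ s, IsBoundedUnder (· ≤ ·) atTop fun n => f (φ n) x := fun x hx =>
    isBoundedUnder_of ⟨B x, fun n => (abs_le.1 (hB (φ n) x hx)).2⟩
  have hge : ∀ x ∈ s, IsBoundedUnder (· ≥ ·) atTop fun n => f (φ n) x := fun x hx =>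
    isBoundedUnder_of ⟨-B x, fun n => (abs_le.1 (hB (φ n) x hx)).1⟩
  let l : ℝ → ℝ := fun x => liminf (fun n => f (φ n) x) atTop
  let u : ℝ → ℝ := fun x => limsup (fun n => f (φ n) x) atTop
  have hl : MonotoneOn l s := fun x hx y hy hxy =>
    liminf_le_liminf (Eventually.of_forall fun n => hf _ hx hy hxy) (hge x hx)
      (hle y hy).isCoboundedUnder_ge
  have hu : MonotoneOn u s := fun x hx y hy hxy =>
    limsup_le_limsup (Eventually.of_forall fun n => hf _ hx hy hxy)
      (hge x hx).isCoboundedUnder_le (hle y hy)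
  refine ⟨φ, hφ, l, hl, _, hl.countable_not_continuousWithinAt, ?_⟩
  rintro x ⟨hx, hxt⟩
  have hcont : ContinuousAt l x := by
    have h : ContinuousWithinAt l s x := by
      by_contra h
      exact hxt ⟨hx, h⟩
    exact h.continuousAt (hs.mem_nhds hx)
  refine tendsto_of_liminf_eq_limsup rfl (le_antisymm ?_ ?_) (hle x hx) (hge x hx)
  · by_contra! hlt
    have hev : ∀ᶠ y in nhds x, l y < u x ∧ y ∈ s :=
      (hcont.eventually_lt_const hlt).and (hs.mem_nhds hx)
    obtain ⟨c, hc, hsub⟩ := exists_Ico_subset_of_mem_nhds hev (exists_gt x)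
    obtain ⟨q, hxq, hqc⟩ := exists_rat_btwn hc
    obtain ⟨hlq, hqs⟩ := hsub ⟨hxq.le, hqc⟩
    have h1 : u x ≤ u q := hu hx hqs hxq.le
    have h2 : u q = l q := (hGq q hqs).limsup_eq.trans (hGq q hqs).liminf_eq.symm
    linarith
  · exact liminf_le_limsup (hle x hx) (hge x hx)

theorem MonotoneOn.sq_mul_min_le {g : ℝ → ℝ} (hg : MonotoneOn g Omg) {M : ℝ} (hM : 0 ≤ M)
    (hbd : ∫⁻ m, ENNReal.ofReal (g m ^ 2) ∂mu ≤ ENNReal.ofReal M) {x : ℝ} (hx : x ∈ Omg) :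
    g x ^ 2 * min x (1 - x) ≤ M := by
  have key : ∀ a b : ℝ, a ≤ b → Set.Ioo a b ⊆ Omg →
      (∀ y ∈ Set.Ioo a b, g x ^ 2 ≤ g y ^ 2) → g x ^ 2 * (b - a) ≤ M := by
    intro a b hab hsub hle
    refine (ENNReal.ofReal_le_ofReal_iff hM).1 (le_trans ?_ hbd)
    calc ENNReal.ofReal (g x ^ 2 * (b - a))
        = ∫⁻ _ in Set.Ioo a b, ENNReal.ofReal (g x ^ 2) := by
          rw [setLIntegral_const, Real.volume_Ioo, ENNReal.ofReal_mul (sq_nonneg _)]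
      _ ≤ ∫⁻ y in Set.Ioo a b, ENNReal.ofReal (g y ^ 2) :=
          setLIntegral_mono' measurableSet_Ioo fun y hy => ENNReal.ofReal_le_ofReal (hle y hy)
      _ ≤ ∫⁻ m, ENNReal.ofReal (g m ^ 2) ∂mu := lintegral_mono_set hsub
  obtain ⟨h0, h1⟩ := hx
  rcases le_total 0 (g x) with h | h
  · refine le_trans ?_ (key x 1 h1.le (Set.Ioo_subset_Ioo_left h0.le) fun y hy => ?_)
    · exact mul_le_mul_of_nonneg_left (min_le_right _ _) (sq_nonneg _)
    · have := hg ⟨h0, h1⟩ ⟨h0.trans hy.1, hy.2⟩ hy.1.le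
      nlinarith
  · refine le_trans ?_ (key 0 x h0.le (Set.Ioo_subset_Ioo_right h1.le) fun y hy => ?_)
    · rw [sub_zero]
      exact mul_le_mul_of_nonneg_left (min_le_left _ _) (sq_nonneg _)
    · have := hg ⟨hy.1, hy.2.trans h1⟩ ⟨h0, h1⟩ hy.2.le
      nlinarith

theorem eLpNorm_two_le_of_lintegral_sq_le {Ω : Type*} [MeasurableSpace Ω] {μ : Measure Ω}
    {f : Ω → ℝ} {e : ℝ} (he : 0 ≤ e)
    (h : ∫⁻ m, ENNReal.ofReal (f m ^ 2) ∂μ ≤ ENNReal.ofReal (e ^ 2)) :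
    eLpNorm f 2 μ ≤ ENNReal.ofReal e := by
  have h2 : eLpNorm f 2 μ ^ 2 = ∫⁻ m, ENNReal.ofReal (f m ^ 2) ∂μ := by
    have := eLpNorm_nnreal_pow_eq_lintegral (f := f) (μ := μ) (p := 2) two_ne_zero
    simp only [ENNReal.coe_ofNat, NNReal.coe_ofNat, ENNReal.rpow_ofNat] at this
    rw [this]
    refine lintegral_congr fun m => ?_
    rw [Real.enorm_eq_ofReal_abs, ← ENNReal.ofReal_pow (abs_nonneg _), sq_abs]
  rw [← h2, ENNReal.ofReal_pow he] at h
  exact (ENNReal.pow_le_pow_left_iff two_ne_zero).1 h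

theorem exists_mul_sq_le_of_tendsto {ψ : ℝ → ℝ}
    (hsuper : Tendsto (fun r : ℝ => ψ r / r ^ 2) (cocompact ℝ) atTop) (A : ℝ) :
    ∃ R : ℝ, 0 < R ∧ ∀ r : ℝ, R ≤ |r| → A * r ^ 2 ≤ ψ r := by
  have h := hsuper.eventually_ge_atTop A
  rw [← Metric.cobounded_eq_cocompact] at h
  obtain ⟨R, -, hR⟩ := hasBasis_cobounded_norm.eventually_iff.1 h
  refine ⟨max R 1, by positivity, fun r hr => ?_⟩
  have h1 : A ≤ ψ r / r ^ 2 := hR (show R ≤ ‖r‖ from (le_max_left _ _).trans hr)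
  have h2 : 0 < r ^ 2 := by
    have : 0 < |r| := lt_of_lt_of_le (by positivity) hr
    rw [← sq_abs]
    positivity
  exact (le_div_iff₀ h2).1 h1

instance : IsProbabilityMeasure mu := ⟨by simp [mu, Omg]⟩

/-- De la Vallée-Poussin: bounded superquadratic energy gives uniform integrability in `L²`. -/
theorem unifIntegrable_two_of_lintegral_le {Ω ι : Type*} [MeasurableSpace Ω] {μ : Measure Ω}
    {ψ : ℝ → ℝ} (hnonneg : ∀ r : ℝ, 0 ≤ ψ r)
    (hsuper : Tendsto (fun r : ℝ => ψ r / r ^ 2) (cocompact ℝ) atTop) {f : ι → Ω → ℝ}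
    (hf : ∀ i, AEStronglyMeasurable (f i) μ) {α : ℝ} (hα : 0 ≤ α)
    (hbd : ∀ i, ∫⁻ m, ENNReal.ofReal (ψ (f i m)) ∂μ ≤ ENNReal.ofReal α) :
    UnifIntegrable f 2 μ := by
  refine unifIntegrable_of one_le_two ENNReal.ofNat_ne_top hf fun ε hε => ?_
  have hA : 0 < (α + 1) / ε ^ 2 := by positivity
  obtain ⟨R, hR0, hR⟩ := exists_mul_sq_le_of_tendsto hsuper ((α + 1) / ε ^ 2)
  refine ⟨⟨R, hR0.le⟩, fun i => eLpNorm_two_le_of_lintegral_sq_le hε.le ?_⟩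
  set c : ℝ := ε ^ 2 / (α + 1) with hc
  have hc0 : 0 ≤ c := by positivity
  calc ∫⁻ m, ENNReal.ofReal
          (({x | (⟨R, hR0.le⟩ : ℝ≥0) ≤ ‖f i x‖₊}.indicator (f i) m) ^ 2) ∂μ
      ≤ ∫⁻ m, ENNReal.ofReal c * ENNReal.ofReal (ψ (f i m)) ∂μ := by
        refine lintegral_mono fun m => ?_
        rw [← ENNReal.ofReal_mul hc0]
        refine ENNReal.ofReal_le_ofReal ?_
        by_cases hm : (⟨R, hR0.le⟩ : ℝ≥0) ≤ ‖f i m‖₊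
        · rw [Set.indicator_of_mem (show m ∈ {x | (⟨R, hR0.le⟩ : ℝ≥0) ≤ ‖f i x‖₊} from hm)]
          have h1 := mul_le_mul_of_nonneg_left (hR (f i m) hm) hc0
          have h2 : c * ((α + 1) / ε ^ 2 * f i m ^ 2) = f i m ^ 2 := by
            rw [hc]
            field_simp
          rwa [h2] at h1
        · rw [Set.indicator_of_notMem (show m ∉ {x | (⟨R, hR0.le⟩ : ℝ≥0) ≤ ‖f i x‖₊} from hm)]
          simpa using mul_nonneg hc0 (hnonneg _)
    _ = ENNReal.ofReal c * ∫⁻ m, ENNReal.ofReal (ψ (f i m)) ∂μ :=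
        lintegral_const_mul' _ _ ENNReal.ofReal_ne_top
    _ ≤ ENNReal.ofReal c * ENNReal.ofReal α := by gcongr; exact hbd i
    _ ≤ ENNReal.ofReal (ε ^ 2) := by
        rw [← ENNReal.ofReal_mul hc0]
        refine ENNReal.ofReal_le_ofReal ?_
        rw [hc, div_mul_eq_mul_div, div_le_iff₀ (by positivity)]
        nlinarith [sq_nonneg ε]

/-- **Compactness in `K`.** If `ψ : ℝ → [0,∞)` is even and convex with
`ψ(r)/r² → ∞` as `|r| → ∞`, then every sublevel set `{X ∈ K : Ψ[X] ≤ α}` of the associated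
integral functional is compact in `L²(Ω)`. -/
theorem stmt2 (ψ : ℝ → ℝ)
    (hnonneg : ∀ r : ℝ, 0 ≤ ψ r)
    (heven : ∀ r : ℝ, ψ (-r) = ψ r)
    (hconv : ConvexOn ℝ Set.univ ψ)
    (hsuper : Tendsto (fun r : ℝ => ψ r / r ^ 2) (cocompact ℝ) atTop) :
    ∀ α : ℝ, 0 ≤ α →
      IsCompact {X : L2 | X ∈ Kcone ∧ PsiL ψ X ≤ ENNReal.ofReal α} := by
  intro α hα
  have hψ : Continuous ψ := continuousOn_univ.1 (hconv.continuousOn isOpen_univ)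
  obtain ⟨R, hR0, hR⟩ := exists_mul_sq_le_of_tendsto hsuper 1
  have hsq : ∀ r : ℝ, r ^ 2 ≤ R ^ 2 + ψ r := by
    intro r
    rcases le_total R |r| with h | h
    · nlinarith [hR r h, sq_nonneg R]
    · nlinarith [hnonneg r, sq_abs r, abs_nonneg r]
  refine IsSeqCompact.isCompact fun X hX => ?_
  choose g hg hXg using fun n => (hX n).1
  have hM : 0 ≤ R ^ 2 + α := by positivity
  have hgint : ∀ n, ∫⁻ m, ENNReal.ofReal (g n m ^ 2) ∂mu ≤ ENNReal.ofReal (R ^ 2 + α) := by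
    intro n
    calc ∫⁻ m, ENNReal.ofReal (g n m ^ 2) ∂mu
        = ∫⁻ m, ENNReal.ofReal (X n m ^ 2) ∂mu :=
          lintegral_congr_ae <| (hXg n).mono fun m hm => by simp only [hm]
      _ ≤ ∫⁻ m, (ENNReal.ofReal (R ^ 2) + ENNReal.ofReal (ψ (X n m))) ∂mu := by
          refine lintegral_mono fun m => ?_
          rw [← ENNReal.ofReal_add (sq_nonneg R) (hnonneg _)]
          exact ENNReal.ofReal_le_ofReal (hsq _)
      _ = ENNReal.ofReal (R ^ 2) + PsiL ψ (X n) := by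
          rw [lintegral_add_left measurable_const]
          simp [PsiL]
      _ ≤ ENNReal.ofReal (R ^ 2 + α) := by
          rw [ENNReal.ofReal_add (sq_nonneg R) hα]
          gcongr
          exact (hX n).2
  have hB : ∀ n, ∀ x ∈ Omg, |g n x| ≤ √((R ^ 2 + α) / min x (1 - x)) := by
    intro n x hx
    have hmin : 0 < min x (1 - x) := lt_min hx.1 (sub_pos.2 hx.2)
    exact Real.abs_le_sqrt ((le_div_iff₀ hmin).2 ((hg n).sq_mul_min_le hM (hgint n) hx))
  obtain ⟨φ, hφ, l, hl, t, ht, hlim⟩ :=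
    exists_subseq_tendsto_of_monotoneOn (s := Omg) isOpen_Ioo hg hB
  have hae : ∀ᵐ x ∂mu, Tendsto (fun n => X (φ n) x) atTop (nhds (l x)) := by
    have h1 : ∀ᵐ x ∂mu, x ∈ Omg := ae_restrict_mem measurableSet_Ioo
    have h2 : ∀ᵐ x ∂mu, x ∉ t := ae_restrict_of_ae (ht.ae_notMem volume)
    filter_upwards [h1, h2, ae_all_iff.2 hXg] with x hx hxt hxg
    simpa only [hxg] using hlim x ⟨hx, hxt⟩
  have hui : UnifIntegrable (fun n => ⇑(X (φ n))) 2 mu :=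
    unifIntegrable_two_of_lintegral_le hnonneg hsuper (fun n => Lp.aestronglyMeasurable _) hα
      fun n => (hX (φ n)).2
  have hbound : ∀ n, eLpNorm (X n) 2 mu ≤ ENNReal.ofReal √(R ^ 2 + α) := by
    intro n
    rw [eLpNorm_congr_ae (hXg n)]
    refine eLpNorm_two_le_of_lintegral_sq_le (Real.sqrt_nonneg _) ?_
    rw [Real.sq_sqrt hM]
    exact hgint n
  have hmem : MemLp l 2 mu := by
    refine UniformIntegrable.memLp_of_ae_tendsto (u := atTop)
      (f := fun n => ⇑(X (φ n))) ⟨fun n => Lp.aestronglyMeasurable _, hui, ?_⟩ hae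
    exact ⟨Real.toNNReal √(R ^ 2 + α), fun n => hbound (φ n)⟩
  refine ⟨hmem.toLp l, ⟨⟨l, hl, hmem.coeFn_toLp⟩, ?_⟩, φ, hφ, ?_⟩
  · calc PsiL ψ (hmem.toLp l)
        = ∫⁻ m, liminf (fun n => ENNReal.ofReal (ψ (X (φ n) m))) atTop ∂mu := by
          refine lintegral_congr_ae ?_
          filter_upwards [hmem.coeFn_toLp, hae] with m hm hlm
          rw [hm]
          exact (ENNReal.tendsto_ofReal ((hψ.tendsto _).comp hlm)).liminf_eq.symm
      _ ≤ liminf (fun n => PsiL ψ (X (φ n))) atTop :=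
          lintegral_liminf_le' fun n => ENNReal.measurable_ofReal.comp_aemeasurable
            (hψ.measurable.comp_aemeasurable (Lp.aestronglyMeasurable _).aemeasurable)
      _ ≤ ENNReal.ofReal α :=
          liminf_le_of_le (by isBoundedDefault) fun b hb => by
            obtain ⟨n, hn⟩ := hb.exists
            exact hn.trans (hX (φ n)).2
  · exact (Lp.tendsto_Lp_iff_tendsto_eLpNorm _ _ hmem).2
      (tendsto_Lp_finite_of_tendsto_ae one_le_two ENNReal.ofNat_ne_top
        (fun n => Lp.aestronglyMeasurable _) hmem hui hae)
end
end

section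
/- Let X ∈ K and W ∈ L²(Ω), and let Ξ_W(m) := ∫₀^m W(s) ds for m ∈ [0,1] be the primitive of W. Then W ∈ N_X K if and only if Ξ_W(m) ≥ 0 for all m ∈ [0,1] and Ξ_W(m) = 0 for every m ∈ [0,1] ∖ Ω_X (in particular Ξ_W(1) = 0). -/
open MeasureTheory Set Filter
open scoped ENNReal NNReal RealInnerProductSpace

noncomputable section

/-- The normal cone to `K` at `X`. -/
def normalCone (X : L2) : Set L2 := {W | ∀ Y ∈ Kcone, ⟪W, Y - X⟫ ≤ 0}

/-- `Ω_X`: points of `Ω` near which `X` is (essentially) constant. -/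
def OmegaX (X : L2) : Set ℝ :=
  {m | m ∈ Omg ∧ ∃ U ∈ nhds m, ∃ c : ℝ, ∀ᵐ x ∂(mu.restrict U), X x = c}

/-- The primitive `Ξ_W(m) = ∫₀^m W(s) ds`. -/
def XiW (W : L2) (m : ℝ) : ℝ := ∫ s in Set.Ioo (0:ℝ) m, W s

/-- The layer-cake kernel `1_{t < u} - 1_{t < 0}`, whose integral over `t` is `u`. -/
def layer (t u : ℝ) : ℝ := (if t < u then 1 else 0) - (if t < 0 then 1 else 0)

lemma layer_eq (t u : ℝ) :
    layer t u = (Ico 0 u).indicator 1 t - (Ico u 0).indicator 1 t := by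
  simp only [layer, indicator, mem_Ico, Pi.one_apply]
  grind

lemma abs_layer_eq (t u : ℝ) :
    |layer t u| = (Ico 0 u).indicator 1 t + (Ico u 0).indicator 1 t := by
  simp only [layer, indicator, mem_Ico, Pi.one_apply]
  grind

lemma integrable_indicator_Ico (a b : ℝ) :
    Integrable ((Ico a b).indicator (1 : ℝ → ℝ)) :=
  (integrable_indicator_iff measurableSet_Ico).2 (integrableOn_const (by simp))

lemma integrable_layer (u : ℝ) : Integrable (fun t => layer t u) := by
  simp only [layer_eq]
  exact (integrable_indicator_Ico 0 u).sub (integrable_indicator_Ico u 0)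

lemma integral_layer (u : ℝ) : ∫ t, layer t u = u := by
  simp only [layer_eq]
  rw [integral_sub (integrable_indicator_Ico 0 u) (integrable_indicator_Ico u 0),
    integral_indicator_one measurableSet_Ico, integral_indicator_one measurableSet_Ico,
    Real.volume_real_Ico, Real.volume_real_Ico]
  rcases le_total u 0 with h | h <;> simp [h]

lemma integral_abs_layer (u : ℝ) : ∫ t, |layer t u| = |u| := by
  simp only [abs_layer_eq]
  rw [integral_add (integrable_indicator_Ico 0 u) (integrable_indicator_Ico u 0),
    integral_indicator_one measurableSet_Ico, integral_indicator_one measurableSet_Ico,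
    Real.volume_real_Ico, Real.volume_real_Ico]
  rcases le_total u 0 with h | h <;> simp [h, abs_of_nonneg, abs_of_nonpos]

lemma measurable_layer : Measurable (fun p : ℝ × ℝ => layer p.1 p.2) := by
  unfold layer
  exact (Measurable.ite (measurableSet_lt measurable_fst measurable_snd)
    measurable_const measurable_const).sub
    (Measurable.ite (measurableSet_lt measurable_fst measurable_const)
      measurable_const measurable_const)

section LayerCake

variable {α : Type*} [MeasurableSpace α] {ν : Measure α} {w u : α → ℝ}

lemma integrable_mul_layer (hw : Measurable w) (hu : Measurable u)
    (hwu : Integrable (fun x => w x * u x) ν) :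
    Integrable (fun p : α × ℝ => w p.1 * layer p.2 (u p.1)) (ν.prod volume) := by
  have hm : Measurable (fun p : α × ℝ => w p.1 * layer p.2 (u p.1)) :=
    (hw.comp measurable_fst).mul
      (measurable_layer.comp (measurable_snd.prodMk (hu.comp measurable_fst)))
  rw [integrable_prod_iff hm.aestronglyMeasurable]
  refine ⟨ae_of_all _ fun x => (integrable_layer (u x)).const_mul (w x), ?_⟩
  simpa [integral_const_mul, integral_abs_layer, abs_mul] using hwu.norm

lemma integral_mul_eq_integral_layer [SFinite ν] (hw : Measurable w) (hu : Measurable u)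
    (hwu : Integrable (fun x => w x * u x) ν) :
    ∫ x, w x * u x ∂ν = ∫ t, ∫ x, w x * layer t (u x) ∂ν := by
  rw [← integral_integral_swap (f := fun x t => w x * layer t (u x))
    (integrable_mul_layer hw hu hwu)]
  simp [integral_const_mul, integral_layer]

end LayerCake

instance : IsFiniteMeasure mu := by
  unfold mu Omg
  infer_instance

lemma mu_restrict {s : Set ℝ} (hs : MeasurableSet s) :
    mu.restrict s = volume.restrict (s ∩ Omg) := Measure.restrict_restrict hs

lemma measurable_coe (W : L2) : Measurable W := (Lp.stronglyMeasurable W).measurable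

lemma integrable_coe (W : L2) : Integrable W mu :=
  (Lp.memLp W).integrable (by norm_num)

lemma integrable_mul_coe (W U : L2) : Integrable (fun x => W x * U x) mu :=
  (Lp.memLp W).integrable_mul (Lp.memLp U)

lemma inner_eq_integral_mul (W U : L2) : ⟪W, U⟫ = ∫ x, W x * U x ∂mu := by
  rw [L2.inner_def]
  simp [mul_comm]

lemma XiW_zero (W : L2) : XiW W 0 = 0 := by simp [XiW]

lemma XiW_one (W : L2) : XiW W 1 = ∫ x, W x ∂mu := rfl

lemma integral_indicator_Ioi (W : L2) {a : ℝ} (ha : a ∈ Icc (0 : ℝ) 1) :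
    ∫ x, W x * (if a < x then 1 else 0) ∂mu = XiW W 1 - XiW W a := by
  have hW : IntegrableOn W (Ioo 0 1) volume := integrable_coe W
  have h1 : XiW W a = ∫ x, W x * (if x < a then 1 else 0) ∂mu := by
    have : (fun x => W x * (if x < a then (1 : ℝ) else 0)) = (Iio a).indicator W := by
      ext x
      simp [indicator]
    rw [this, integral_indicator measurableSet_Iio, mu_restrict measurableSet_Iio, XiW]
    congr 2
    ext x
    simp only [Omg, mem_Ioo, mem_inter_iff, mem_Iio]
    constructor
    · rintro ⟨h, h'⟩
      exact ⟨h', h, h'.trans_le ha.2⟩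
    · rintro ⟨h, h', -⟩
      exact ⟨h', h⟩
  have hi : Integrable (fun x => W x * (if x < a then (1 : ℝ) else 0)) mu := by
    have : (fun x => W x * (if x < a then (1 : ℝ) else 0)) = (Iio a).indicator W := by
      ext x
      simp [indicator]
    rw [this]
    exact (integrable_coe W).indicator measurableSet_Iio
  rw [h1, XiW_one, ← integral_sub (integrable_coe W) hi]
  refine integral_congr_ae ?_
  have hne : ∀ᵐ x ∂mu, x ≠ a := by
    have : ∀ᵐ x ∂(volume : Measure ℝ), x ≠ a := by simp [ae_iff]
    exact ae_restrict_of_ae this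
  filter_upwards [hne] with x hx
  rcases lt_or_gt_of_ne hx with h | h <;> simp [h, h.not_gt]

lemma continuousOn_XiW (W : L2) : ContinuousOn (XiW W) (Icc 0 1) := by
  have hW : IntegrableOn W (Icc 0 1) volume :=
    (integrableOn_Icc_iff_integrableOn_Ioo (by simp) (by simp)).2 (integrable_coe W)
  have h := intervalIntegral.continuousOn_primitive hW
  simp only [integral_Ioc_eq_integral_Ioo] at h
  exact h

/-- `a` separates the sublevel set `{g ≤ t}` from the superlevel set `{g > t}` in `Ω`. -/
def IsLevelCut (g : ℝ → ℝ) (t a : ℝ) : Prop :=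
  a ∈ Icc (0 : ℝ) 1 ∧ ∀ x ∈ Omg, (x < a → g x ≤ t) ∧ (a < x → t < g x)

lemma exists_isLevelCut {g : ℝ → ℝ} (hg : MonotoneOn g Omg) (t : ℝ) :
    ∃ a, IsLevelCut g t a := by
  set S : Set ℝ := insert 1 {x | x ∈ Omg ∧ t < g x} with hS
  have hbdd : BddBelow S := by
    refine ⟨0, ?_⟩
    rintro x (rfl | ⟨hx, -⟩)
    exacts [zero_le_one, hx.1.le]
  have hne : S.Nonempty := ⟨1, mem_insert _ _⟩
  refine ⟨sInf S, ⟨le_csInf hne ?_, csInf_le hbdd (mem_insert _ _)⟩, fun x hx => ⟨?_, ?_⟩⟩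
  · rintro x (rfl | ⟨hx, -⟩)
    exacts [zero_le_one, hx.1.le]
  · intro h
    by_contra! hlt
    exact h.not_ge (csInf_le hbdd (Or.inr ⟨hx, hlt⟩))
  · intro h
    obtain ⟨y, hy, hyx⟩ := exists_lt_of_csInf_lt hne h
    rcases hy with rfl | ⟨hy, hty⟩
    · exact absurd hx.2 hyx.not_gt
    · exact hty.trans_le (hg hy hx hyx.le)

lemma integral_mul_layer_of_isLevelCut {U W : L2} {g : ℝ → ℝ} (hU : U =ᵐ[mu] g)
    (h1 : XiW W 1 = 0) {t a : ℝ} (ha : IsLevelCut g t a) :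
    ∫ x, W x * layer t (U x) ∂mu = -XiW W a := by
  have hne : ∀ᵐ x ∂mu, x ≠ a := by
    have : ∀ᵐ x ∂(volume : Measure ℝ), x ≠ a := by simp [ae_iff]
    exact ae_restrict_of_ae this
  have hmem : ∀ᵐ x ∂mu, x ∈ Omg := ae_restrict_mem measurableSet_Ioo
  have hi : Integrable (fun x => W x * (if a < x then (1 : ℝ) else 0)) mu := by
    have : (fun x => W x * (if a < x then (1 : ℝ) else 0)) = (Ioi a).indicator W := by
      ext x
      simp [indicator]
    rw [this]
    exact (integrable_coe W).indicator measurableSet_Ioi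
  have key : ∫ x, W x * layer t (U x) ∂mu =
      ∫ x, (W x * (if a < x then 1 else 0) - W x * (if t < 0 then 1 else 0)) ∂mu := by
    refine integral_congr_ae ?_
    filter_upwards [hne, hmem, hU] with x hx hx' hxU
    rw [hxU, layer, mul_sub]
    congr 3
    rcases lt_or_gt_of_ne hx with h | h
    · simp [h.not_gt, ((ha.2 x hx').1 h).not_gt]
    · simp [h, (ha.2 x hx').2 h]
  rw [key, integral_sub hi ((integrable_coe W).mul_const _), integral_indicator_Ioi W ha.1,
    integral_mul_const, ← XiW_one, h1]
  ring

lemma inner_eq_integral_XiW {U W : L2} {g a : ℝ → ℝ} (hU : U =ᵐ[mu] g)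
    (h1 : XiW W 1 = 0) (ha : ∀ t, IsLevelCut g t (a t)) :
    ⟪W, U⟫ = -∫ t, XiW W (a t) := by
  rw [inner_eq_integral_mul, integral_mul_eq_integral_layer (measurable_coe W)
    (measurable_coe U) (integrable_mul_coe W U), ← integral_neg]
  simp only [integral_mul_layer_of_isLevelCut hU h1 (ha _)]

lemma integrable_XiW_comp {U W : L2} {g a : ℝ → ℝ} (hU : U =ᵐ[mu] g)
    (h1 : XiW W 1 = 0) (ha : ∀ t, IsLevelCut g t (a t)) :
    Integrable (fun t => XiW W (a t)) := by
  have h := (integrable_mul_layer (measurable_coe W) (measurable_coe U)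
    (integrable_mul_coe W U)).integral_prod_right
  simp only [integral_mul_layer_of_isLevelCut hU h1 (ha _)] at h
  simpa using h.neg

lemma IsLevelCut.notMem_OmegaX {U : L2} {g : ℝ → ℝ} (hU : U =ᵐ[mu] g) {t a : ℝ}
    (ha : IsLevelCut g t a) : a ∉ OmegaX U := by
  rintro ⟨haO, V, hV, c, hc⟩
  obtain ⟨l, r, ⟨hl, hr⟩, hlr⟩ := mem_nhds_iff_exists_Ioo_subset.1
    (inter_mem hV (isOpen_Ioo.mem_nhds haO))
  have hgc : ∀ᵐ x ∂(volume : Measure ℝ), x ∈ Ioo l r → g x = c := by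
    have h1 : ∀ᵐ x ∂(mu.restrict V), g x = c := by
      filter_upwards [hc, ae_restrict_of_ae hU] with x hx hx'
      rw [← hx', hx]
    have h2 : mu.restrict (Ioo l r) = volume.restrict (Ioo l r) := by
      rw [mu_restrict measurableSet_Ioo]
      congr 1
      exact inter_eq_left.2 fun x hx => (hlr hx).2
    have h3 := ae_restrict_of_ae_restrict_of_subset (fun x hx => (hlr hx).1) h1
    rw [h2] at h3
    exact (ae_restrict_iff' measurableSet_Ioo).1 h3
  obtain ⟨x, hx, hlx, hxa⟩ := (Measure.dense_of_ae hgc).exists_between hl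
  obtain ⟨y, hy, hay, hyr⟩ := (Measure.dense_of_ae hgc).exists_between hr
  have hxm : x ∈ Ioo l r := ⟨hlx, hxa.trans hr⟩
  have hym : y ∈ Ioo l r := ⟨hl.trans hay, hyr⟩
  have h1 := (ha.2 x (hlr hxm).2).1 hxa
  have h2 := (ha.2 y (hlr hym).2).2 hay
  rw [hx hxm] at h1
  rw [hy hym] at h2
  exact h2.not_ge h1

lemma XiW_eq_zero_of_notMem_OmegaX {X W : L2} {g a : ℝ → ℝ}
    (hX : X =ᵐ[mu] g) (ha : ∀ t, IsLevelCut g t (a t))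
    (hnn : ∀ m ∈ Icc (0 : ℝ) 1, 0 ≤ XiW W m) (h1 : XiW W 1 = 0) (h0 : ⟪W, X⟫ = 0)
    {m : ℝ} (hm : m ∈ Icc (0 : ℝ) 1) (hmX : m ∉ OmegaX X) : XiW W m = 0 := by
  rcases hm.1.eq_or_lt with rfl | hm0
  · exact XiW_zero W
  rcases hm.2.eq_or_lt with rfl | hm1
  · exact h1
  by_contra hne
  have hpos : 0 < XiW W m := lt_of_le_of_ne (hnn m hm) (Ne.symm hne)
  have hev : ∀ᶠ x in nhds m, 0 < XiW W x :=
    ((continuousOn_XiW W).continuousAt (Icc_mem_nhds hm0 hm1)).eventually (lt_mem_nhds hpos)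
  obtain ⟨l, r, hlr, hsub⟩ := mem_nhds_iff_exists_Ioo_subset.1
    (inter_mem hev (isOpen_Ioo.mem_nhds (show m ∈ Ioo (0 : ℝ) 1 from ⟨hm0, hm1⟩)))
  have hconst : ∃ x ∈ Ioo l r, g x ≠ g m := by
    by_contra! hcon
    refine hmX ⟨⟨hm0, hm1⟩, Ioo l r, isOpen_Ioo.mem_nhds hlr, g m, ?_⟩
    filter_upwards [ae_restrict_of_ae hX, ae_restrict_mem measurableSet_Ioo] with x hx hx'
    rw [hx, hcon x hx']
  obtain ⟨u, hu, v, hv, huv⟩ : ∃ u ∈ Ioo l r, ∃ v ∈ Ioo l r, g u < g v := by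
    obtain ⟨x, hx, hxm⟩ := hconst
    rcases lt_or_gt_of_ne hxm with h | h
    exacts [⟨x, hx, m, hlr, h⟩, ⟨m, hlr, x, hx, h⟩]
  have hint : ∫ t, XiW W (a t) = 0 := by
    have := inner_eq_integral_XiW hX h1 ha
    linarith
  have hae : ∀ᵐ t ∂(volume : Measure ℝ), XiW W (a t) = 0 :=
    (integral_eq_zero_iff_of_nonneg (fun t => hnn _ (ha t).1)
      (integrable_XiW_comp hX h1 ha)).1 hint
  obtain ⟨t, ht, hut, htv⟩ := (Measure.dense_of_ae hae).exists_between huv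
  have hua : u ≤ a t := by
    by_contra! h
    exact hut.not_gt (((ha t).2 u (hsub hu).2).2 h)
  have hav : a t ≤ v := by
    by_contra! h
    exact htv.not_ge (((ha t).2 v (hsub hv).2).1 h)
  have : 0 < XiW W (a t) := (hsub ⟨hu.1.trans_le hua, hav.trans_lt hv.2⟩).1
  exact this.ne' ht

/-- A nondecreasing square-integrable function defines an element of `K`. -/
lemma toLp_mem_Kcone {g : ℝ → ℝ} (hg : Monotone g) (h : MemLp g 2 mu) :
    h.toLp g ∈ Kcone := ⟨g, hg.monotoneOn _, h.coeFn_toLp⟩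

lemma inner_toLp (W : L2) {g : ℝ → ℝ} (h : MemLp g 2 mu) :
    ⟪W, h.toLp g⟫ = ∫ x, W x * g x ∂mu := by
  rw [inner_eq_integral_mul]
  refine integral_congr_ae ?_
  filter_upwards [h.coeFn_toLp] with x hx
  rw [hx]

lemma smul_mem_Kcone {X : L2} (hX : X ∈ Kcone) {c : ℝ} (hc : 0 ≤ c) : c • X ∈ Kcone := by
  obtain ⟨g, hg, hXg⟩ := hX
  refine ⟨fun x => c * g x, fun x hx y hy h => mul_le_mul_of_nonneg_left (hg hx hy h) hc, ?_⟩
  filter_upwards [Lp.coeFn_smul c X, hXg] with x hx hx'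
  simp [hx, hx']

lemma mem_normalCone_iff {X W : L2} (hX : X ∈ Kcone) :
    W ∈ normalCone X ↔ ⟪W, X⟫ = 0 ∧ ∀ Y ∈ Kcone, ⟪W, Y⟫ ≤ 0 := by
  constructor
  · intro h
    have h0 := h _ (smul_mem_Kcone hX le_rfl)
    have h2 := h _ (smul_mem_Kcone hX zero_le_two)
    rw [inner_sub_right, inner_smul_right] at h0 h2
    have hWX : ⟪W, X⟫ = 0 := by linarith
    refine ⟨hWX, fun Y hY => ?_⟩
    have := h Y hY
    rwa [inner_sub_right, hWX, sub_zero] at this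
  · rintro ⟨h0, h⟩ Y hY
    rw [inner_sub_right, h0, sub_zero]
    exact h Y hY

lemma XiW_one_eq_zero_of_polar {W : L2} (h : ∀ Y ∈ Kcone, ⟪W, Y⟫ ≤ 0) : XiW W 1 = 0 := by
  have hc : ∀ c : ℝ, XiW W 1 * c ≤ 0 := fun c => by
    have := h _ (toLp_mem_Kcone (g := fun _ => c) monotone_const (memLp_const c))
    rwa [inner_toLp, integral_mul_const, ← XiW_one] at this
  have h1 := hc 1
  have h2 := hc (-1)
  linarith

lemma XiW_nonneg_of_polar {W : L2} (h : ∀ Y ∈ Kcone, ⟪W, Y⟫ ≤ 0) {m : ℝ}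
    (hm : m ∈ Icc (0 : ℝ) 1) : 0 ≤ XiW W m := by
  have hmono : Monotone (fun x : ℝ => if m < x then (1 : ℝ) else 0) := by
    intro x y hxy
    dsimp only
    grind
  have hLp : MemLp (fun x : ℝ => if m < x then (1 : ℝ) else 0) 2 mu :=
    MemLp.of_bound hmono.measurable.aestronglyMeasurable 1
      (ae_of_all _ fun x => by split_ifs <;> simp)
  have := h _ (toLp_mem_Kcone hmono hLp)
  rw [inner_toLp, integral_indicator_Ioi W hm, XiW_one_eq_zero_of_polar h] at this
  linarith

/-- Let `X ∈ K` and `W ∈ L²(Ω)`. Then `W ∈ N_X K` if and only if the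
primitive `Ξ_W` is nonnegative on `[0,1]` and vanishes at every point of `[0,1] ∖ Ω_X`. -/
theorem stmt3 (X : L2) (hX : X ∈ Kcone) (W : L2) :
    W ∈ normalCone X ↔
      ((∀ m ∈ Set.Icc (0:ℝ) 1, 0 ≤ XiW W m) ∧
        (∀ m ∈ Set.Icc (0:ℝ) 1, m ∉ OmegaX X → XiW W m = 0)) := by
  obtain ⟨g, hg, hXg⟩ := id hX
  rw [mem_normalCone_iff hX]
  choose a ha using exists_isLevelCut hg
  constructor
  · rintro ⟨h0, h⟩
    have hnn : ∀ m ∈ Set.Icc (0:ℝ) 1, 0 ≤ XiW W m := fun m hm => XiW_nonneg_of_polar h hm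
    exact ⟨hnn, fun m hm hmX => XiW_eq_zero_of_notMem_OmegaX hXg ha hnn
      (XiW_one_eq_zero_of_polar h) h0 hm hmX⟩
  · rintro ⟨hnn, hz⟩
    have h1 : XiW W 1 = 0 := hz 1 (by simp) fun h => lt_irrefl _ h.1.2
    constructor
    · rw [inner_eq_integral_XiW hXg h1 ha]
      simp [fun t => hz _ (ha t).1 ((ha t).notMem_OmegaX hXg)]
    · rintro Y ⟨f, hf, hYf⟩
      choose b hb using exists_isLevelCut hf
      rw [inner_eq_integral_XiW hYf h1 hb, neg_nonpos]
      exact integral_nonneg fun t => hnn _ (hb t).1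
end
end

section
/- Let X ∈ K. Then the tangent cone T_X K equals the set of all U ∈ L²(Ω) that admit a representative which is nondecreasing on each connected component (α,β) of Ω_X. -/
open MeasureTheory Set Filter
open scoped ENNReal NNReal RealInnerProductSpace

noncomputable section

/-- The tangent cone to `K` at `X`: the `L²`-closure of `{θ(Y − X) : Y ∈ K, θ ≥ 0}`. -/
def tangentCone (X : L2) : Set L2 :=
  closure {U | ∃ Y ∈ Kcone, ∃ θ : ℝ, 0 ≤ θ ∧ U = θ • (Y - X)}

instance isFiniteMeasure_mu : IsFiniteMeasure mu := by
  unfold mu Omg; infer_instance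

lemma ae_mem_Omg : ∀ᵐ x ∂mu, x ∈ Omg := ae_restrict_mem measurableSet_Ioo

lemma mu_absolutelyContinuous : mu ≪ volume := Measure.absolutelyContinuous_of_le
  Measure.restrict_le_self

lemma exists_mem_Ioo_of_ae {P : ℝ → Prop} (hP : ∀ᵐ x ∂mu, P x) {a b : ℝ} (hab : a < b)
    (hsub : Ioo a b ⊆ Omg) : ∃ z ∈ Ioo a b, P z := by
  by_contra! hcon
  have h1 : mu (Ioo a b) = 0 := measure_mono_null hcon hP
  rw [mu, Measure.restrict_apply measurableSet_Ioo, inter_eq_left.2 hsub, Real.volume_Ioo] at h1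
  simp at h1
  linarith

lemma isOpen_OmegaX (X : L2) : IsOpen (OmegaX X) := by
  rw [isOpen_iff_mem_nhds]
  rintro m ⟨hm, U, hU, c, hc⟩
  filter_upwards [isOpen_Ioo.mem_nhds hm, eventually_mem_nhds_iff.2 hU] with x hx hxU
  exact ⟨hx, U, hxU, c, hc⟩

lemma OmegaX_subset (X : L2) : OmegaX X ⊆ Omg := fun _ h => h.1

lemma mem_OmegaX_of_eq {X : L2} {h : ℝ → ℝ} (hm : MonotoneOn h Omg) (hX : ⇑X =ᵐ[mu] h)
    {x m y : ℝ} (hx : x ∈ Omg) (hy : y ∈ Omg) (hxm : x < m) (hmy : m < y) (hxy : h x = h y) :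
    m ∈ OmegaX X := by
  refine ⟨⟨hx.1.trans hxm, hmy.trans hy.2⟩, Ioo x y, Ioo_mem_nhds hxm hmy, h x, ?_⟩
  rw [ae_restrict_iff' measurableSet_Ioo]
  filter_upwards [hX] with z hz hzm
  have hzO : z ∈ Omg := ⟨hx.1.trans hzm.1, hzm.2.trans hy.2⟩
  rw [hz]
  exact le_antisymm (hxy ▸ hm hzO hy hzm.2.le) (hm hx hzO hzm.1.le)

lemma eventually_eq_of_mem_OmegaX {X : L2} {h : ℝ → ℝ} (hm : MonotoneOn h Omg)
    (hX : ⇑X =ᵐ[mu] h) {m : ℝ} (hmX : m ∈ OmegaX X) : ∃ c, ∀ᶠ x in nhds m, h x = c := by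
  obtain ⟨hmO, U, hU, c, hc⟩ := hmX
  obtain ⟨V, hVU, hVo, hmV⟩ := mem_nhds_iff.1 hU
  have hc' := ae_restrict_of_ae_restrict_of_subset hVU hc
  rw [ae_restrict_iff' hVo.measurableSet] at hc'
  have key : ∀ᵐ x ∂mu, x ∈ V → h x = c := by
    filter_upwards [hc', hX] with x h1 h2 h3
    rw [← h2, h1 h3]
  obtain ⟨a, b, hab, hsub⟩ := mem_nhds_iff_exists_Ioo_subset.1
    (inter_mem (hVo.mem_nhds hmV) (isOpen_Ioo.mem_nhds hmO))
  refine ⟨c, ?_⟩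
  filter_upwards [Ioo_mem_nhds hab.1 hab.2] with x hx
  have hs1 : Ioo a x ⊆ Ioo a b := Ioo_subset_Ioo_right hx.2.le
  have hs2 : Ioo x b ⊆ Ioo a b := Ioo_subset_Ioo_left hx.1.le
  obtain ⟨u, hu, hu'⟩ := exists_mem_Ioo_of_ae key hx.1 fun t ht => (hsub (hs1 ht)).2
  obtain ⟨v, hv, hv'⟩ := exists_mem_Ioo_of_ae key hx.2 fun t ht => (hsub (hs2 ht)).2
  have hu1 := hsub (hs1 hu)
  have hv1 := hsub (hs2 hv)
  have hx1 := hsub hx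
  rw [← hu' hu1.1]
  refine le_antisymm ?_ (hm hu1.2 hx1.2 hu.2.le)
  rw [hu' hu1.1, ← hv' hv1.1]
  exact hm hx1.2 hv1.2 hv.1.le

lemma eq_on_component {X : L2} {h : ℝ → ℝ} (hm : MonotoneOn h Omg) (hX : ⇑X =ᵐ[mu] h)
    {m x y : ℝ} (hx : x ∈ connectedComponentIn (OmegaX X) m)
    (hy : y ∈ connectedComponentIn (OmegaX X) m) : h x = h y := by
  have hd : ∀ z ∈ connectedComponentIn (OmegaX X) m, HasDerivAt h 0 z := fun z hz => by
    obtain ⟨c, hc⟩ := eventually_eq_of_mem_OmegaX hm hX (connectedComponentIn_subset _ _ hz)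
    exact (hasDerivAt_const z c).congr_of_eventuallyEq hc
  exact (isOpen_OmegaX X).connectedComponentIn.is_const_of_deriv_eq_zero
    isPreconnected_connectedComponentIn
    (fun z hz => (hd z hz).differentiableAt.differentiableWithinAt)
    (fun z hz => (hd z hz).deriv) hx hy

/-- A component of `Ω_X` is an open interval whose endpoints are not in `Ω_X`. -/
lemma component_eq_Ioo {X : L2} {m : ℝ} (hmX : m ∈ OmegaX X) :
    ∃ a b, a ∉ OmegaX X ∧ b ∉ OmegaX X ∧ a < b ∧ Ioo a b ⊆ Omg ∧
      connectedComponentIn (OmegaX X) m = Ioo a b := by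
  set C := connectedComponentIn (OmegaX X) m with hC
  have hmC : m ∈ C := mem_connectedComponentIn hmX
  have hCO : C ⊆ Omg := (connectedComponentIn_subset _ _).trans (OmegaX_subset X)
  have hop : IsOpen C := (isOpen_OmegaX X).connectedComponentIn
  have hpre : IsPreconnected C := isPreconnected_connectedComponentIn
  have hb : BddBelow C := ⟨0, fun x hx => (hCO hx).1.le⟩
  have ha : BddAbove C := ⟨1, fun x hx => (hCO hx).2.le⟩
  have hne : C.Nonempty := ⟨m, hmC⟩
  have hclos : ∀ z ∈ closure C, z ∈ OmegaX X → z ∈ C := fun z hz hzX => by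
    have := (hpre.subset_closure (subset_insert z C)
      (insert_subset hz subset_closure)).subset_connectedComponentIn
      (mem_insert_of_mem z hmC) (insert_subset hzX (connectedComponentIn_subset _ _))
    exact this (mem_insert z C)
  have h1 : sInf C ∉ C := fun hmem => by
    obtain ⟨a, b, hab, hsub⟩ := mem_nhds_iff_exists_Ioo_subset.1 (hop.mem_nhds hmem)
    obtain ⟨t, ht1, ht2⟩ := exists_between hab.1
    exact (csInf_le hb (hsub ⟨ht1, ht2.trans hab.2⟩)).not_gt ht2
  have h2 : sSup C ∉ C := fun hmem => by
    obtain ⟨a, b, hab, hsub⟩ := mem_nhds_iff_exists_Ioo_subset.1 (hop.mem_nhds hmem)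
    obtain ⟨t, ht1, ht2⟩ := exists_between hab.2
    exact (le_csSup ha (hsub ⟨hab.1.trans ht1, ht2⟩)).not_gt ht1
  have hlt1 : ∀ x ∈ C, sInf C < x := fun x hx =>
    lt_of_le_of_ne (csInf_le hb hx) fun he => h1 (he ▸ hx)
  have hlt2 : ∀ x ∈ C, x < sSup C := fun x hx =>
    lt_of_le_of_ne (le_csSup ha hx) fun he => h2 (he ▸ hx)
  have hsub : Ioo (sInf C) (sSup C) ⊆ C := IsConnected.Ioo_csInf_csSup_subset ⟨hne, hpre⟩ hb ha
  exact ⟨sInf C, sSup C, fun h => h1 (hclos _ (csInf_mem_closure hne hb) h),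
    fun h => h2 (hclos _ (csSup_mem_closure hne ha) h), (hlt1 m hmC).trans (hlt2 m hmC),
    hsub.trans hCO, Subset.antisymm (fun x hx => ⟨hlt1 x hx, hlt2 x hx⟩) hsub⟩

/-- The functions with a representative nondecreasing on each component of `Ω_X`. -/
def monoOnComponents (X : L2) : Set L2 :=
  {U : L2 | ∃ g : ℝ → ℝ, ⇑U =ᵐ[mu] g ∧
    ∀ m ∈ OmegaX X, MonotoneOn g (connectedComponentIn (OmegaX X) m)}

/-- Monotonicity on a conull subset of each component can be upgraded to the whole component. -/
lemma mem_monoOnComponents_of_ae {X U : L2} {S : Set ℝ} (hS : ∀ᵐ x ∂mu, x ∈ S)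
    (hU : ∀ m ∈ OmegaX X, MonotoneOn U (S ∩ connectedComponentIn (OmegaX X) m)) :
    U ∈ monoOnComponents X := by
  classical
  let T : ℝ → Set ℝ := fun x => S ∩ connectedComponentIn (OmegaX X) x
  refine ⟨fun x => if x ∈ OmegaX X then sSup (U '' (T x ∩ Iic x)) else U x, ?_, ?_⟩
  · filter_upwards [hS] with x hx
    split_ifs with hxX
    · have hxT : x ∈ T x := ⟨hx, mem_connectedComponentIn hxX⟩
      have hgr : IsGreatest (U '' (T x ∩ Iic x)) (U x) := by
        refine ⟨⟨x, ⟨hxT, le_refl x⟩, rfl⟩, ?_⟩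
        rintro _ ⟨y, hy, rfl⟩
        exact hU x hxX hy.1 hxT hy.2
      exact hgr.csSup_eq.symm
    · rfl
  · intro m hm x hx y hy hxy
    have hxX := connectedComponentIn_subset _ _ hx
    have hyX := connectedComponentIn_subset _ _ hy
    obtain ⟨a, b, -, -, -, hO, hC⟩ := component_eq_Ioo hm
    have hTx : T x = S ∩ Ioo a b := by simp only [T]; rw [← connectedComponentIn_eq hx, hC]
    have hTy : T y = S ∩ Ioo a b := by simp only [T]; rw [← connectedComponentIn_eq hy, hC]
    have hUm := hU m hm
    rw [hC] at hx hy hUm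
    simp only [hxX, hyX, if_true, hTx, hTy]
    obtain ⟨u, hu, huS⟩ := exists_mem_Ioo_of_ae hS hx.1
      ((Ioo_subset_Ioo_right hx.2.le).trans hO)
    obtain ⟨v, hv, hvS⟩ := exists_mem_Ioo_of_ae hS hy.2
      ((Ioo_subset_Ioo_left hy.1.le).trans hO)
    have hne : (U '' ((S ∩ Ioo a b) ∩ Iic x)).Nonempty :=
      ⟨U u, u, ⟨⟨huS, hu.1, hu.2.trans hx.2⟩, hu.2.le⟩, rfl⟩
    have hbdd : BddAbove (U '' ((S ∩ Ioo a b) ∩ Iic y)) := by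
      refine ⟨U v, ?_⟩
      rintro _ ⟨t, ht, rfl⟩
      exact hUm ht.1 ⟨hvS, hy.1.trans hv.1, hv.2⟩ (le_trans ht.2 hv.1.le)
    exact csSup_le_csSup hbdd hne
      (image_mono (inter_subset_inter_right _ (Iic_subset_Iic.2 hxy)))

lemma isClosed_monoOnComponents (X : L2) : IsClosed (monoOnComponents X) := by
  refine isClosed_of_closure_subset fun U hU => ?_
  obtain ⟨V, hV, hlim⟩ := mem_closure_iff_seq_limit.1 hU
  obtain ⟨φ, -, hφ⟩ := (tendstoInMeasure_of_tendsto_Lp hlim).exists_seq_tendsto_ae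
  choose g hg hmono using hV
  refine mem_monoOnComponents_of_ae
    (S := {x | Tendsto (fun i => V (φ i) x) atTop (nhds (U x)) ∧ ∀ n, V n x = g n x})
    (hφ.and (ae_all_iff.2 hg)) fun m hm x hx y hy hxy => ?_
  refine le_of_tendsto_of_tendsto' hx.1.1 hy.1.1 fun i => ?_
  rw [hx.1.2, hy.1.2]
  exact hmono _ m hm hx.2 hy.2 hxy

lemma tangentCone_subset {X : L2} (hX : X ∈ Kcone) : tangentCone X ⊆ monoOnComponents X := by
  refine closure_minimal ?_ (isClosed_monoOnComponents X)
  rintro _ ⟨Y, ⟨y, hy, hYy⟩, θ, hθ, rfl⟩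
  obtain ⟨h, hh, hXh⟩ := hX
  refine ⟨fun x => θ * (y x - h x), ?_, fun m hm s hs t ht hst => ?_⟩
  · filter_upwards [Lp.coeFn_smul θ (Y - X), Lp.coeFn_sub Y X, hYy, hXh] with x h1 h2 h3 h4
    rw [h1, Pi.smul_apply, h2, Pi.sub_apply, h3, h4, smul_eq_mul]
  · have hsub := (connectedComponentIn_subset (OmegaX X) m).trans (OmegaX_subset X)
    have := eq_on_component hh hXh hs ht
    have := hy (hsub hs) (hsub ht) hst
    exact mul_le_mul_of_nonneg_left (by linarith) hθ

/-- `Z` lies in the polar of the feasible directions `g` at the monotone function `h`. -/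
def IsPolar (h Z : ℝ → ℝ) : Prop :=
  ∀ g : ℝ → ℝ, MemLp g 2 mu → MonotoneOn (fun x => h x + g x) Omg → ∫ x, Z x * g x ∂mu ≤ 0

lemma memLp_clamp {g : ℝ → ℝ} (hg : AEMeasurable g mu) (a b : ℝ) :
    MemLp (fun x => max a (min (g x) b)) 2 mu := by
  refine MemLp.of_bound (C := max |a| |b|)
    (aemeasurable_const.max (hg.min aemeasurable_const)).aestronglyMeasurable
    (Eventually.of_forall fun x => ?_)
  rw [Real.norm_eq_abs]
  refine abs_le.2 ⟨?_, ?_⟩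
  · exact ((neg_le_neg (le_max_left _ _)).trans (neg_abs_le a)).trans (le_max_left _ _)
  · exact max_le_max (le_abs_self a) ((min_le_right _ _).trans (le_abs_self b))

lemma memLp_indicator_const {s : Set ℝ} (hs : MeasurableSet s) (c : ℝ) :
    MemLp (s.indicator fun _ => c) 2 mu := (memLp_const c).indicator hs

namespace IsPolar

variable {h Z : ℝ → ℝ}

lemma integral_mul_nonpos (hZ : IsPolar h Z) (hh : MonotoneOn h Omg) {g : ℝ → ℝ}
    (hg : MemLp g 2 mu) (hgm : MonotoneOn g Omg) : ∫ x, Z x * g x ∂mu ≤ 0 :=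
  hZ g hg (hh.add hgm)

lemma integral_eq_zero (hZ : IsPolar h Z) (hh : MonotoneOn h Omg) : ∫ x, Z x ∂mu = 0 := by
  have h1 := hZ.integral_mul_nonpos hh (memLp_const 1) monotoneOn_const
  have h2 := hZ.integral_mul_nonpos hh (memLp_const (-1)) monotoneOn_const
  simp only [mul_one, mul_neg, integral_neg] at h1 h2
  linarith

lemma setIntegral_Iic_nonneg (hZ : IsPolar h Z) (hh : MonotoneOn h Omg) (x : ℝ) :
    0 ≤ ∫ t in Iic x, Z t ∂mu := by
  have h1 := hZ.integral_mul_nonpos hh (memLp_indicator_const (measurableSet_Iic (a := x)) (-1))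
    (fun s _ t _ hst => by
      simp only [indicator_apply, mem_Iic]
      split_ifs <;> linarith)
  have h2 : (fun t => Z t * (Iic x).indicator (fun _ => (-1 : ℝ)) t)
      = (Iic x).indicator (fun t => - Z t) := by
    ext t; by_cases ht : t ∈ Iic x <;> simp [ht]
  rw [h2, integral_indicator measurableSet_Iic, integral_neg] at h1
  linarith

lemma integral_mul_clamp_nonneg (hZ : IsPolar h Z) (hh : MonotoneOn h Omg) {c d : ℝ}
    (hcd : c < d) : 0 ≤ ∫ x, Z x * ((max c (min (h x) d) - c) / (d - c)) ∂mu := by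
  have hmeas : AEMeasurable h mu := aemeasurable_restrict_of_monotoneOn measurableSet_Ioo hh
  have h1 := hZ (fun x => -(max c (min (h x) d) - c))
    ((memLp_clamp hmeas c d).sub (memLp_const c)).neg (fun s hs t ht hst => by
      have := hh hs ht hst
      simp only
      grind)
  have h2 : ∀ x, Z x * ((max c (min (h x) d) - c) / (d - c))
      = -(d - c)⁻¹ * (Z x * -(max c (min (h x) d) - c)) := fun x => by
    rw [div_eq_mul_inv]; ring
  simp_rw [h2]
  rw [integral_const_mul]
  exact mul_nonneg_of_nonpos_of_nonpos (by simpa using hcd.le) h1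

lemma setIntegral_Iic_eq_zero {X : L2} (hZ : IsPolar h Z) (hh : MonotoneOn h Omg)
    (hX : ⇑X =ᵐ[mu] h) (hZ2 : MemLp Z 2 mu) {m : ℝ} (hm : m ∉ OmegaX X) :
    ∫ t in Iic m, Z t ∂mu = 0 := by
  have hZi : Integrable Z mu := hZ2.integrable (by norm_num)
  have htot := hZ.integral_eq_zero hh
  rcases le_or_gt m 0 with hm0 | hm0
  · rw [Measure.restrict_eq_zero.2, integral_zero_measure]
    refine measure_mono_null (t := Omgᶜ) (fun t ht htO => ?_) ae_mem_Omg
    exact (htO.1.trans_le (le_trans ht hm0)).false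
  rcases le_or_gt 1 m with hm1 | hm1
  · rw [Measure.restrict_eq_self_of_ae_mem, htot]
    filter_upwards [ae_mem_Omg] with t ht
    exact ht.2.le.trans hm1
  refine le_antisymm ?_ (hZ.setIntegral_Iic_nonneg hh m)
  have hex : ∀ n : ℕ, ∃ x y, x ∈ Omg ∧ y ∈ Omg ∧ x < m ∧ m < y ∧
      m - 1 / ((n : ℝ) + 1) < x ∧ y < m + 1 / ((n : ℝ) + 1) ∧ h x < h y := fun n => by
    have hpos : 0 < 1 / ((n : ℝ) + 1) := Nat.one_div_pos_of_nat
    obtain ⟨x, hx1, hx2⟩ := exists_between (max_lt hm0 (sub_lt_self m hpos))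
    obtain ⟨y, hy1, hy2⟩ := exists_between (lt_min hm1 (lt_add_of_pos_right m hpos))
    rw [max_lt_iff] at hx1
    rw [lt_min_iff] at hy2
    have hxO : x ∈ Omg := ⟨hx1.1, hx2.trans hm1⟩
    have hyO : y ∈ Omg := ⟨hm0.trans hy1, hy2.1⟩
    exact ⟨x, y, hxO, hyO, hx2, hy1, hx1.2, hy2.2, lt_of_le_of_ne
      (hh hxO hyO (hx2.trans hy1).le) fun he => hm (mem_OmegaX_of_eq hh hX hxO hyO hx2 hy1 he)⟩
  choose x y hxO hyO hxm hmy hx hy hxy using hex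
  have hmeas : AEMeasurable h mu := aemeasurable_restrict_of_monotoneOn measurableSet_Ioo hh
  let ψ : ℕ → ℝ → ℝ := fun n t =>
    (max (h (x n)) (min (h t) (h (y n))) - h (x n)) / (h (y n) - h (x n))
  have hlim : Tendsto (fun n => ∫ t, Z t * ψ n t ∂mu) atTop
      (nhds (∫ t, (Ioi m).indicator Z t ∂mu)) := by
    refine tendsto_integral_of_dominated_convergence (fun t => ‖Z t‖) (fun n => ?_) hZi.norm
      (fun n => Eventually.of_forall fun t => ?_) ?_
    · exact hZi.aestronglyMeasurable.mul (((aemeasurable_const.max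
        (hmeas.min aemeasurable_const)).sub aemeasurable_const).div_const _).aestronglyMeasurable
    · rw [norm_mul]
      refine mul_le_of_le_one_right (norm_nonneg _) ?_
      have hpos := sub_pos.2 (hxy n)
      rw [Real.norm_eq_abs, abs_le]
      constructor
      · exact le_trans (by norm_num) (div_nonneg (sub_nonneg.2 (le_max_left _ _)) hpos.le)
      · rw [div_le_one hpos]
        exact sub_le_sub_right (max_le (hxy n).le (min_le_right _ _)) _
    · have hmne : ∀ᵐ t ∂mu, t ≠ m := mu_absolutelyContinuous.ae_le (Measure.ae_ne volume m)
      filter_upwards [ae_mem_Omg, hmne] with t htO htm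
      have hdist : 0 < |t - m| := abs_pos.2 (sub_ne_zero.2 htm)
      have hev : ∀ᶠ n : ℕ in atTop, 1 / ((n : ℝ) + 1) < |t - m| :=
        tendsto_one_div_add_atTop_nhds_zero_nat.eventually_lt_const hdist
      refine tendsto_const_nhds.congr' ?_
      filter_upwards [hev] with n hn
      have hpos := sub_pos.2 (hxy n)
      rcases lt_or_gt_of_ne htm with hlt | hgt
      · rw [abs_of_neg (sub_neg.2 hlt)] at hn
        have hle := hh htO (hxO n) (by linarith [hx n])
        have : ψ n t = 0 := by
          simp only [ψ]
          rw [max_eq_left ((min_le_left _ _).trans hle), sub_self, zero_div]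
        simp [this, hlt.le]
      · rw [abs_of_pos (sub_pos.2 hgt)] at hn
        have hle := hh (hyO n) htO (by linarith [hy n])
        have : ψ n t = 1 := by
          simp only [ψ]
          rw [min_eq_right hle, max_eq_right (hxy n).le, div_self hpos.ne']
        simp [this, hgt]
  have hge := ge_of_tendsto' hlim fun n => hZ.integral_mul_clamp_nonneg hh (hxy n)
  rw [integral_indicator measurableSet_Ioi] at hge
  have := integral_add_compl (μ := mu) (measurableSet_Iic (a := m)) hZi
  rw [compl_Iic, htot] at this
  linarith

lemma ae_eq_zero {X : L2} (hZ : IsPolar h Z) (hh : MonotoneOn h Omg)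
    (hX : ⇑X =ᵐ[mu] h) (hZ2 : MemLp Z 2 mu) : ∀ᵐ x ∂mu, x ∉ OmegaX X → Z x = 0 := by
  have hZi : Integrable Z mu := hZ2.integrable (by norm_num)
  have hzi : Integrable (Omg.indicator Z) volume :=
    (integrable_indicator_iff measurableSet_Ioo).2 hZi
  have hI : ∀ x, ∫ t in Iic x, Omg.indicator Z t = ∫ t in Iic x, Z t ∂mu := fun x => by
    rw [mu, Measure.restrict_restrict measurableSet_Iic]
    exact setIntegral_indicator measurableSet_Ioo
  have hF : ∀ x, ∫ t in (0 : ℝ)..x, Omg.indicator Z t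
      = ∫ t in Iic x, Z t ∂mu - ∫ t in Iic 0, Z t ∂mu := fun x => by
    rw [← hI, ← hI, intervalIntegral.integral_Iic_sub_Iic hzi.integrableOn hzi.integrableOn]
  have h0 : (0 : ℝ) ∉ OmegaX X := fun hc => lt_irrefl _ hc.1.1
  filter_upwards [ae_mem_Omg,
    mu_absolutelyContinuous.ae_le
      (LocallyIntegrable.ae_hasDerivAt_integral hzi.locallyIntegrable)] with x hxO hx hxX
  have hd := hx 0
  simp_rw [hF, hZ.setIntegral_Iic_eq_zero hh hX hZ2 h0, sub_zero] at hd
  have hmin : IsLocalMin (fun x => ∫ t in Iic x, Z t ∂mu) x := Eventually.of_forall fun y => by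
    simp only
    rw [hZ.setIntegral_Iic_eq_zero hh hX hZ2 hxX]
    exact hZ.setIntegral_Iic_nonneg hh y
  simpa [hxO] using hmin.hasDerivAt_eq_zero hd

lemma setIntegral_Ioo_clamp_nonpos (hZ : IsPolar h Z) (hh : MonotoneOn h Omg)
    (hZ2 : MemLp Z 2 mu) {a b : ℝ} (hab : a < b)
    (ha : ∫ t in Iic a, Z t ∂mu = 0) (hb : ∫ t in Iic b, Z t ∂mu = 0) {g : ℝ → ℝ}
    (hg : AEMeasurable g mu) (hgm : MonotoneOn g (Ioo a b)) {k : ℝ} (hk : 0 ≤ k) :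
    ∫ t in Ioo a b, Z t * max (-k) (min (g t) k) ∂mu ≤ 0 := by
  have hZi : Integrable Z mu := hZ2.integrable (by norm_num)
  let T : ℝ → ℝ := fun t => max (-k) (min (g t) k)
  have hT : MemLp T 2 mu := memLp_clamp hg _ _
  have hTl : ∀ t, -k ≤ T t := fun t => le_max_left _ _
  have hTu : ∀ t, T t ≤ k := fun t => max_le (by linarith) (min_le_right _ _)
  have hTm : MonotoneOn T (Ioo a b) := fun s hs t ht hst =>
    max_le_max le_rfl (min_le_min (hgm hs ht hst) le_rfl)
  have h1 := hZ.integral_mul_nonpos hh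
    (g := fun t => (Ioo a b).indicator T t + (Iic a).indicator (fun _ => -k) t +
      (Ici b).indicator (fun _ => k) t)
    (((hT.indicator measurableSet_Ioo).add (memLp_indicator_const measurableSet_Iic _)).add
      (memLp_indicator_const measurableSet_Ici _)) (fun s _ t _ hst => by
        have h2 : s ∈ Ioo a b → t ∈ Ioo a b → T s ≤ T t := fun hs ht => hTm hs ht hst
        have := hTl s
        have := hTu s
        have := hTl t
        have := hTu t
        simp only [indicator_apply, mem_Ioo, mem_Iic, mem_Ici] at h2 ⊢
        clear_value T
        grind)
  have hZT : Integrable (fun t => Z t * T t) mu := hZ2.integrable_mul hT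
  have h2 : (fun t => Z t * ((Ioo a b).indicator T t + (Iic a).indicator (fun _ => -k) t +
      (Ici b).indicator (fun _ => k) t)) = fun t => (Ioo a b).indicator (fun t => Z t * T t) t +
      (Iic a).indicator (fun t => -k * Z t) t + (Ici b).indicator (fun t => k * Z t) t := by
    ext t
    simp only [indicator_apply]
    split_ifs <;> ring
  have hzb : ∫ t in Ici b, Z t ∂mu = 0 := by
    have h3 := integral_add_compl (μ := mu) (measurableSet_Iio (a := b)) hZi
    have h4 : Iio b =ᵐ[mu] Iic b := mu_absolutelyContinuous.ae_le Iio_ae_eq_Iic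
    rw [compl_Iio, setIntegral_congr_set h4, hb, hZ.integral_eq_zero hh] at h3
    linarith
  rw [h2, integral_add, integral_add, integral_indicator measurableSet_Ioo,
    integral_indicator measurableSet_Iic, integral_indicator measurableSet_Ici,
    integral_const_mul, integral_const_mul, ha, hzb] at h1
  · simpa using h1
  · exact hZT.indicator measurableSet_Ioo
  · exact (hZi.const_mul _).indicator measurableSet_Iic
  · exact (hZT.indicator measurableSet_Ioo).add ((hZi.const_mul _).indicator measurableSet_Iic)
  · exact (hZi.const_mul _).indicator measurableSet_Ici

lemma setIntegral_Ioo_nonpos (hZ : IsPolar h Z) (hh : MonotoneOn h Omg)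
    (hZ2 : MemLp Z 2 mu) {a b : ℝ} (hab : a < b)
    (ha : ∫ t in Iic a, Z t ∂mu = 0) (hb : ∫ t in Iic b, Z t ∂mu = 0) {g : ℝ → ℝ}
    (hg : MemLp g 2 mu) (hgm : MonotoneOn g (Ioo a b)) :
    ∫ t in Ioo a b, Z t * g t ∂mu ≤ 0 := by
  have hgmeas := hg.aestronglyMeasurable.aemeasurable
  have hZg : Integrable (fun t => Z t * g t) mu := hZ2.integrable_mul hg
  have hlim : Tendsto (fun n : ℕ => ∫ t in Ioo a b, Z t * max (-(n : ℝ)) (min (g t) n) ∂mu) atTop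
      (nhds (∫ t in Ioo a b, Z t * g t ∂mu)) := by
    refine tendsto_integral_of_dominated_convergence (fun t => ‖Z t * g t‖) (fun n => ?_)
      hZg.norm.integrableOn (fun n => Eventually.of_forall fun t => ?_)
      (Eventually.of_forall fun t => ?_)
    · exact (hZ2.aestronglyMeasurable.mul
        (memLp_clamp hgmeas _ _).aestronglyMeasurable).mono_measure Measure.restrict_le_self
    · rw [norm_mul, norm_mul]
      refine mul_le_mul_of_nonneg_left ?_ (norm_nonneg _)
      have : (0 : ℝ) ≤ n := n.cast_nonneg
      rw [Real.norm_eq_abs, Real.norm_eq_abs]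
      grind
    · refine tendsto_const_nhds.congr' ?_
      filter_upwards [eventually_ge_atTop ⌈|g t|⌉₊] with n hn
      have h1 : |g t| ≤ n := Nat.ceil_le.1 hn
      rw [abs_le] at h1
      rw [min_eq_left h1.2, max_eq_right h1.1]
  exact le_of_tendsto' hlim fun n =>
    hZ.setIntegral_Ioo_clamp_nonpos hh hZ2 hab ha hb hgmeas hgm n.cast_nonneg

lemma integral_mul_nonpos_of_mono_components {X : L2} (hZ : IsPolar h Z) (hh : MonotoneOn h Omg)
    (hX : ⇑X =ᵐ[mu] h) (hZ2 : MemLp Z 2 mu) {g : ℝ → ℝ} (hg : MemLp g 2 mu)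
    (hgm : ∀ m ∈ OmegaX X, MonotoneOn g (connectedComponentIn (OmegaX X) m)) :
    ∫ x, Z x * g x ∂mu ≤ 0 := by
  have hZg : Integrable (fun t => Z t * g t) mu := hZ2.integrable_mul hg
  let 𝒞 : Set (Set ℝ) := connectedComponentIn (OmegaX X) '' OmegaX X
  have hopen : ∀ C ∈ 𝒞, IsOpen C := by
    rintro _ ⟨m, -, rfl⟩
    exact (isOpen_OmegaX X).connectedComponentIn
  have hdisj : 𝒞.PairwiseDisjoint id := by
    rintro _ ⟨m, -, rfl⟩ _ ⟨n, -, rfl⟩ hne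
    refine Set.disjoint_left.2 fun t ht1 ht2 => hne ?_
    simp only [id] at ht1 ht2
    rw [connectedComponentIn_eq ht1, connectedComponentIn_eq ht2]
  have hcount : 𝒞.Countable := hdisj.countable_of_isOpen (fun C hC => hopen C hC) (by
    rintro _ ⟨m, hm, rfl⟩
    exact ⟨m, mem_connectedComponentIn hm⟩)
  have : Countable 𝒞 := hcount.to_subtype
  have hU : OmegaX X = ⋃ C : 𝒞, (C : Set ℝ) := by
    ext t
    simp only [mem_iUnion, Subtype.exists, exists_prop]
    constructor
    · exact fun ht => ⟨_, ⟨t, ht, rfl⟩, mem_connectedComponentIn ht⟩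
    · rintro ⟨_, ⟨m, -, rfl⟩, ht⟩
      exact connectedComponentIn_subset _ _ ht
  have hrest : ∫ x, Z x * g x ∂mu = ∫ x in OmegaX X, Z x * g x ∂mu := by
    rw [← integral_indicator (isOpen_OmegaX X).measurableSet]
    refine integral_congr_ae ?_
    filter_upwards [hZ.ae_eq_zero hh hX hZ2] with x hx
    by_cases hxX : x ∈ OmegaX X
    · simp [hxX]
    · simp [hxX, hx hxX]
  rw [hrest, hU, integral_iUnion (fun C : 𝒞 => (hopen C C.2).measurableSet)
    (fun (C D : 𝒞) hne => hdisj C.2 D.2 (Subtype.coe_injective.ne hne)) hZg.integrableOn]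
  refine tsum_nonpos ?_
  rintro ⟨_, m, hm, rfl⟩
  obtain ⟨a, b, ha, hb, hab, -, hC⟩ := component_eq_Ioo hm
  have hgm' := hgm m hm
  simp only [hC] at hgm' ⊢
  exact hZ.setIntegral_Ioo_nonpos hh hZ2 hab (hZ.setIntegral_Iic_eq_zero hh hX hZ2 ha)
    (hZ.setIntegral_Iic_eq_zero hh hX hZ2 hb) hg hgm'

end IsPolar

/-- The feasible directions `θ(Y − X)` at `X`. -/
def feasible (X : L2) : Set L2 := {U | ∃ Y ∈ Kcone, ∃ θ : ℝ, 0 ≤ θ ∧ U = θ • (Y - X)}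

lemma smul_add_smul_mem_Kcone {Y Y' : L2} (hY : Y ∈ Kcone) (hY' : Y' ∈ Kcone) {a b : ℝ}
    (ha : 0 ≤ a) (hb : 0 ≤ b) : a • Y + b • Y' ∈ Kcone := by
  obtain ⟨y, hy, hYy⟩ := hY
  obtain ⟨y', hy', hYy'⟩ := hY'
  refine ⟨fun x => a * y x + b * y' x, fun s hs t ht hst => ?_, ?_⟩
  · exact add_le_add (mul_le_mul_of_nonneg_left (hy hs ht hst) ha)
      (mul_le_mul_of_nonneg_left (hy' hs ht hst) hb)
  · filter_upwards [Lp.coeFn_add (a • Y) (b • Y'), Lp.coeFn_smul a Y, Lp.coeFn_smul b Y', hYy,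
      hYy'] with x h1 h2 h3 h4 h5
    rw [h1, Pi.add_apply, h2, h3, Pi.smul_apply, Pi.smul_apply, h4, h5, smul_eq_mul, smul_eq_mul]

lemma smul_mem_feasible {X V : L2} (hV : V ∈ feasible X) {a : ℝ} (ha : 0 ≤ a) :
    a • V ∈ feasible X := by
  obtain ⟨Y, hY, θ, hθ, rfl⟩ := hV
  exact ⟨Y, hY, a * θ, mul_nonneg ha hθ, smul_smul _ _ _⟩

lemma add_mem_feasible {X V W : L2} (hV : V ∈ feasible X) (hW : W ∈ feasible X) :
    V + W ∈ feasible X := by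
  obtain ⟨Y, hY, θ, hθ, rfl⟩ := hV
  obtain ⟨Y', hY', η, hη, rfl⟩ := hW
  rcases (add_nonneg hθ hη).eq_or_lt with h0 | hpos
  · obtain ⟨rfl, rfl⟩ := (add_eq_zero_iff_of_nonneg hθ hη).1 h0.symm
    exact ⟨Y, hY, 0, le_rfl, by simp⟩
  · refine ⟨(θ / (θ + η)) • Y + (η / (θ + η)) • Y', smul_add_smul_mem_Kcone hY hY'
      (div_nonneg hθ hpos.le) (div_nonneg hη hpos.le), θ + η, hpos.le, ?_⟩
    rw [smul_sub (θ + η), smul_add, smul_smul, smul_smul, mul_div_cancel₀ _ hpos.ne',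
      mul_div_cancel₀ _ hpos.ne']
    module

lemma convex_feasible (X : L2) : Convex ℝ (feasible X) := fun _ hV _ hW _ _ ha hb _ =>
  add_mem_feasible (smul_mem_feasible hV ha) (smul_mem_feasible hW hb)

lemma inner_eq_integral (Z : L2) {V : L2} {g : ℝ → ℝ} (hV : ⇑V =ᵐ[mu] g) :
    ⟪Z, V⟫ = ∫ x, Z x * g x ∂mu := by
  rw [L2.inner_def]
  refine integral_congr_ae ?_
  filter_upwards [hV] with x hx
  simp [hx, mul_comm]

lemma isPolar_of_inner_nonpos {X Z : L2} {h : ℝ → ℝ} (hX : ⇑X =ᵐ[mu] h)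
    (hZ : ∀ V ∈ feasible X, ⟪Z, V⟫ ≤ 0) : IsPolar h Z := fun g hg hgm => by
  rw [← inner_eq_integral Z hg.coeFn_toLp]
  refine hZ _ ⟨X + hg.toLp g, ⟨_, hgm, ?_⟩, 1, zero_le_one, by simp⟩
  filter_upwards [Lp.coeFn_add X (hg.toLp g), hg.coeFn_toLp, hX] with x h1 h2 h3
  rw [h1, Pi.add_apply, h2, h3]

lemma monoOnComponents_subset {X : L2} (hX : X ∈ Kcone) : monoOnComponents X ⊆ tangentCone X := by
  rintro U ⟨g, hUg, hgm⟩
  have hXK := hX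
  obtain ⟨h, hh, hXh⟩ := hX
  by_contra hU
  obtain ⟨f, u, hfu, hu⟩ := geometric_hahn_banach_closed_point
    (convex_feasible X).closure isClosed_closure (show U ∉ closure (feasible X) from hU)
  obtain ⟨Z, rfl⟩ := (InnerProductSpace.toDual ℝ L2).surjective f
  simp only [InnerProductSpace.toDual_apply_apply] at hfu hu
  have hu0 : 0 < u := by
    simpa using hfu 0 (subset_closure ⟨X, hXK, 0, le_rfl, by simp⟩)
  have hZ : ∀ V ∈ feasible X, ⟪Z, V⟫ ≤ 0 := fun V hV => by
    by_contra! hpos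
    have h1 := hfu _ (subset_closure (smul_mem_feasible hV (div_pos hu0 hpos).le))
    rw [inner_smul_right, div_mul_cancel₀ _ hpos.ne'] at h1
    exact lt_irrefl _ h1
  have hg2 : MemLp g 2 mu := (memLp_congr_ae hUg).1 (Lp.memLp U)
  have h2 := (isPolar_of_inner_nonpos hXh hZ).integral_mul_nonpos_of_mono_components hh hXh
    (Lp.memLp Z) hg2 hgm
  rw [← inner_eq_integral Z hUg] at h2
  linarith

/-- For `X ∈ K`, the tangent cone `T_X K` consists exactly of those
`U ∈ L²(Ω)` admitting a representative which is nondecreasing on each connected component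
of `Ω_X`. -/
theorem stmt4 (X : L2) (hX : X ∈ Kcone) :
    tangentCone X =
      {U : L2 | ∃ g : ℝ → ℝ, ⇑U =ᵐ[mu] g ∧
        ∀ m ∈ OmegaX X, MonotoneOn g (connectedComponentIn (OmegaX X) m)} :=
  (tangentCone_subset hX).antisymm (monoOnComponents_subset hX)
end
end

section
/- Let ρ be a Borel probability measure on ℝ, let X_ρ : (0,1) → ℝ be its monotone rearrangement X_ρ(m) = inf{ x ∈ ℝ : ρ((−∞,x]) > m }, and define f_ρ(x) := ρ((−∞,x)) + ρ((−∞,x]) − 1 for x ∈ ℝ. Then for every bounded continuous φ : ℝ → ℝ one has ∫_ℝ φ(x) f_ρ(x) ρ(dx) = ∫₀¹ φ(X_ρ(m)) (2m − 1) dm. (This is the Lagrangian representation of the Euler–Poisson force f[ρ] = f_ρ ρ arising from the interaction potential W(x) = |x|.) -/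
open MeasureTheory Set

noncomputable section

/-- The monotone rearrangement (quantile function) of a probability measure `ρ` on `ℝ`:
`X_ρ(m) = inf { x : ρ((−∞,x]) > m }`. -/
def Xrho (ρ : Measure ℝ) (m : ℝ) : ℝ := sInf {x : ℝ | m < (ρ (Set.Iic x)).toReal}

/-- The precise representative of the Euler–Poisson force density for `W(x) = |x|`:
`f_ρ(x) = ρ((−∞,x)) + ρ((−∞,x]) − 1`. -/
def frho (ρ : Measure ℝ) (x : ℝ) : ℝ := (ρ (Set.Iio x)).toReal + (ρ (Set.Iic x)).toReal - 1

lemma Real.measurable_sign : Measurable Real.sign := by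
  refine Measurable.ite measurableSet_Iio measurable_const ?_
  exact Measurable.ite measurableSet_Ioi measurable_const measurable_const

lemma Real.abs_sign_le_one (x : ℝ) : |Real.sign x| ≤ 1 := by
  obtain h | h | h := Real.sign_apply_eq x <;> simp [h]

lemma integral_sign_sub (μ : Measure ℝ) [IsProbabilityMeasure μ] (a : ℝ) :
    ∫ y, Real.sign (a - y) ∂μ = frho μ a := by
  have h : ∀ y, Real.sign (a - y) =
      (Iio a).indicator (1 : ℝ → ℝ) y + (Iic a).indicator (1 : ℝ → ℝ) y - 1 := by
    intro y
    rcases lt_trichotomy y a with h | h | h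
    · simp [Real.sign_of_pos (sub_pos.2 h), h, h.le]
    · simp [h]
    · simp [Real.sign_of_neg (sub_neg.2 h), h, h.le]
  have h₁ : Integrable ((Iio a).indicator (1 : ℝ → ℝ)) μ :=
    (integrable_const 1).indicator measurableSet_Iio
  have h₂ : Integrable ((Iic a).indicator (1 : ℝ → ℝ)) μ :=
    (integrable_const 1).indicator measurableSet_Iic
  simp_rw [h]
  rw [integral_sub (by exact h₁.add h₂) (integrable_const 1), integral_add h₁ h₂,
    integral_indicator_one measurableSet_Iio, integral_indicator_one measurableSet_Iic]
  simp [frho, measureReal_def]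

lemma measurable_frho (μ : Measure ℝ) [IsProbabilityMeasure μ] : Measurable (frho μ) := by
  refine Monotone.measurable fun x y hxy => ?_
  have h₁ := measureReal_mono (μ := μ) (Iio_subset_Iio hxy)
  have h₂ := measureReal_mono (μ := μ) (Iic_subset_Iic.2 hxy)
  simp only [measureReal_def] at h₁ h₂
  simp only [frho]
  linarith

instance isProbabilityMeasure_restrict_Ioo_zero_one :
    IsProbabilityMeasure (volume.restrict (Ioo (0 : ℝ) 1)) :=
  ⟨by simp⟩

lemma frho_restrict_Ioo {m : ℝ} (hm : m ∈ Ioo (0 : ℝ) 1) :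
    frho (volume.restrict (Ioo (0 : ℝ) 1)) m = 2 * m - 1 := by
  have h₁ : Iio m ∩ Ioo 0 1 = Ioo 0 m := by
    ext x; simp only [mem_inter_iff, mem_Iio, mem_Ioo] at *; grind
  have h₂ : Iic m ∩ Ioo 0 1 = Ioc 0 m := by
    ext x; simp only [mem_inter_iff, mem_Iic, mem_Ioo, mem_Ioc] at *; grind
  rw [frho, Measure.restrict_apply measurableSet_Iio, Measure.restrict_apply measurableSet_Iic,
    h₁, h₂, Real.volume_Ioo, Real.volume_Ioc, ENNReal.toReal_ofReal (by linarith [hm.1])]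
  ring

section Rearrangement

variable (ρ : Measure ℝ) [IsProbabilityMeasure ρ]

lemma nonempty_superlevel_cdf {m : ℝ} (hm : m < 1) :
    {x : ℝ | m < (ρ (Iic x)).toReal}.Nonempty := by
  obtain ⟨x, hx⟩ := ((ProbabilityTheory.tendsto_cdf_atTop ρ).eventually_const_lt hm).exists
  exact ⟨x, by rwa [ProbabilityTheory.cdf_eq_real] at hx⟩

lemma bddBelow_superlevel_cdf {m : ℝ} (hm : 0 < m) : BddBelow {x : ℝ | m < (ρ (Iic x)).toReal} := by
  obtain ⟨x, hx⟩ := ((ProbabilityTheory.tendsto_cdf_atBot ρ).eventually_lt_const hm).exists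
  rw [ProbabilityTheory.cdf_eq_real, measureReal_def] at hx
  refine ⟨x, fun y hy => ?_⟩
  by_contra! hyx
  have h := measureReal_mono (μ := ρ) (Iic_subset_Iic.2 hyx.le)
  simp only [measureReal_def, mem_ofPred_eq] at h hy
  linarith

lemma monotoneOn_Xrho : MonotoneOn (Xrho ρ) (Ioo 0 1) := fun _ ha _ hb hab =>
  csInf_le_csInf (bddBelow_superlevel_cdf ρ ha.1) (nonempty_superlevel_cdf ρ hb.2)
    fun _ hx => hab.trans_lt hx

lemma aemeasurable_Xrho : AEMeasurable (Xrho ρ) (volume.restrict (Ioo (0 : ℝ) 1)) :=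
  aemeasurable_restrict_of_monotoneOn measurableSet_Ioo (monotoneOn_Xrho ρ)

lemma Xrho_le_of_lt {m a : ℝ} (hm : 0 < m) (h : m < (ρ (Iic a)).toReal) : Xrho ρ m ≤ a :=
  csInf_le (bddBelow_superlevel_cdf ρ hm) h

lemma le_of_Xrho_le {m a : ℝ} (hm : m < 1) (h : Xrho ρ m ≤ a) : m ≤ (ρ (Iic a)).toReal := by
  have hcont : Filter.Tendsto (ProbabilityTheory.cdf ρ) (nhdsWithin a (Ioi a))
      (nhds (ProbabilityTheory.cdf ρ a)) :=
    ((ProbabilityTheory.cdf ρ).right_continuous a).mono_left (nhdsWithin_mono _ Ioi_subset_Ici_self)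
  rw [← measureReal_def, ← ProbabilityTheory.cdf_eq_real]
  refine ge_of_tendsto hcont (Filter.eventually_of_mem self_mem_nhdsWithin fun b hb => ?_)
  obtain ⟨x, hx, hxb⟩ := exists_lt_of_csInf_lt (nonempty_superlevel_cdf ρ hm) (h.trans_lt hb)
  rw [mem_ofPred_eq, ← measureReal_def, ← ProbabilityTheory.cdf_eq_real] at hx
  exact hx.le.trans (ProbabilityTheory.monotone_cdf ρ hxb.le)

/-- The monotone rearrangement pushes Lebesgue measure on `(0,1)` forward to `ρ`. -/
lemma map_Xrho : (volume.restrict (Ioo (0 : ℝ) 1)).map (Xrho ρ) = ρ := by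
  have := Measure.isProbabilityMeasure_map (aemeasurable_Xrho ρ)
  refine Measure.ext_of_Iic _ _ fun a => ?_
  have hle : (ρ (Iic a)).toReal ≤ 1 := measureReal_le_one
  have hvol : ENNReal.ofReal ((ρ (Iic a)).toReal - 0) = ρ (Iic a) := by
    rw [sub_zero, ENNReal.ofReal_toReal (measure_ne_top _ _)]
  rw [Measure.map_apply_of_aemeasurable (aemeasurable_Xrho ρ) measurableSet_Iic,
    Measure.restrict_apply' measurableSet_Ioo]
  apply le_antisymm
  · rw [← hvol, ← Real.volume_Ioc]
    exact measure_mono fun m hm => ⟨hm.2.1, le_of_Xrho_le ρ hm.2.2 hm.1⟩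
  · rw [← hvol, ← Real.volume_Ioo]
    exact measure_mono fun m hm =>
      ⟨Xrho_le_of_lt ρ hm.1 hm.2, hm.1, hm.2.trans_le hle⟩

end Rearrangement

lemma MeasureTheory.integral_prod_eq_zero_of_antisymm {α : Type*} [MeasurableSpace α]
    (μ : Measure α) [SFinite μ] (f : α × α → ℝ)
    (h : ∀ᵐ z ∂μ.prod μ, f z.swap = -f z) : ∫ z, f z ∂μ.prod μ = 0 := by
  have h₁ := integral_prod_swap (μ := μ) (ν := μ) f
  rw [integral_congr_ae h, integral_neg] at h₁
  linarith

lemma sign_sub_antisymm_of_monotoneOn {X : ℝ → ℝ} {s : Set ℝ} (hX : MonotoneOn X s)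
    (φ : ℝ → ℝ) {a b : ℝ} (ha : a ∈ s) (hb : b ∈ s) :
    φ (X b) * Real.sign (X b - X a) - φ (X b) * Real.sign (b - a) =
      -(φ (X a) * Real.sign (X a - X b) - φ (X a) * Real.sign (a - b)) := by
  have hsign : ∀ x y : ℝ, Real.sign (x - y) = -Real.sign (y - x) := fun x y => by
    rw [← Real.sign_neg, neg_sub]
  rcases eq_or_ne (X a) (X b) with h | h
  · rw [h, hsign b a, sub_self, Real.sign_zero]; ring
  · suffices Real.sign (X b - X a) = Real.sign (b - a) by
      rw [hsign (X a), hsign a, this]; ring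
    rcases lt_or_gt_of_ne h with h | h
    · rw [Real.sign_of_pos (sub_pos.2 h), Real.sign_of_pos (sub_pos.2 (hX.reflect_lt ha hb h))]
    · rw [Real.sign_of_neg (sub_neg.2 h), Real.sign_of_neg (sub_neg.2 (hX.reflect_lt hb ha h))]

/-- For every Borel probability measure `ρ` on `ℝ` and every bounded
continuous `φ : ℝ → ℝ`, `∫ φ(x) f_ρ(x) ρ(dx) = ∫₀¹ φ(X_ρ(m)) (2m − 1) dm`; this is the
Lagrangian representation of the Euler–Poisson interaction force `f[ρ] = f_ρ ρ`. -/
theorem stmt7 (ρ : Measure ℝ) [IsProbabilityMeasure ρ]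
    (φ : ℝ → ℝ) (hcont : Continuous φ) (hbd : ∃ M : ℝ, ∀ x : ℝ, |φ x| ≤ M) :
    ∫ x, φ x * frho ρ x ∂ρ = ∫ m in Set.Ioo (0:ℝ) 1, φ (Xrho ρ m) * (2 * m - 1) := by
  obtain ⟨M, hM⟩ := hbd
  set ν : Measure ℝ := volume.restrict (Ioo (0 : ℝ) 1) with hν
  set X := Xrho ρ with hX
  have hXm : AEMeasurable X ν := aemeasurable_Xrho ρ
  have hmap : ν.map X = ρ := map_Xrho ρ
  have hint : ∀ g : ℝ × ℝ → ℝ, AEMeasurable g (ν.prod ν) →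
      Integrable (fun z => φ (X z.1) * Real.sign (g z)) (ν.prod ν) := by
    intro g hg
    refine Integrable.of_bound ((hcont.measurable.comp_aemeasurable hXm.comp_fst).mul
      (Real.measurable_sign.comp_aemeasurable hg)).aestronglyMeasurable M (ae_of_all _ fun z => ?_)
    rw [Real.norm_eq_abs, abs_mul]
    simpa using mul_le_mul (hM _) (Real.abs_sign_le_one _) (abs_nonneg _)
      ((abs_nonneg _).trans (hM (X z.1)))
  have hint₁ := hint (fun z => X z.1 - X z.2) (hXm.comp_fst.sub hXm.comp_snd)
  have hint₂ := hint (fun z => z.1 - z.2) (measurable_fst.sub measurable_snd).aemeasurable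
  have hlhs : ∫ x, φ x * frho ρ x ∂ρ =
      ∫ z, φ (X z.1) * Real.sign (X z.1 - X z.2) ∂ν.prod ν := by
    have hmeas : Measurable fun x => φ x * frho ρ x := hcont.measurable.mul (measurable_frho ρ)
    have hfrho : ∀ a, ∫ n, Real.sign (a - X n) ∂ν = frho ρ a := fun a => by
      rw [← integral_sign_sub ρ a]
      conv_rhs => rw [← hmap]
      exact (integral_map hXm (Real.measurable_sign.comp
        (measurable_const.sub measurable_id)).aestronglyMeasurable).symm
    rw [integral_prod _ hint₁]
    simp_rw [integral_const_mul, hfrho]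
    have hmap_int := integral_map hXm hmeas.aestronglyMeasurable
    rwa [hmap] at hmap_int
  have hrhs : ∫ m, φ (X m) * (2 * m - 1) ∂ν =
      ∫ z, φ (X z.1) * Real.sign (z.1 - z.2) ∂ν.prod ν := by
    rw [integral_prod _ hint₂]
    simp_rw [integral_const_mul, integral_sign_sub]
    exact setIntegral_congr_fun measurableSet_Ioo fun m hm => by
      rw [frho_restrict_Ioo hm]
  rw [hlhs, hrhs, ← sub_eq_zero, ← integral_sub hint₁ hint₂]
  refine integral_prod_eq_zero_of_antisymm ν _ ?_
  rw [hν, Measure.prod_restrict]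
  filter_upwards [ae_restrict_mem (measurableSet_Ioo.prod measurableSet_Ioo)] with z hz
  exact sign_sub_antisymm_of_monotoneOn (monotoneOn_Xrho ρ) φ hz.1 hz.2
end
end
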